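/- (Interpolation bound.) There exists a constant C>0 such that for every 0<L_s≤∞, every classical solution of the Boussinesq system with 0≤T₀≤1, and every δ∈(0,1), one has (1/δ)·⟨∫₀^δ u₂T dx₂⟩ ≤ (1/2)·⟨∫₀¹ |∂₂T|² dx₂⟩ + C·δ³·⟨∫₀¹ |∇u|² dx₂⟩^{1/2}·⟨∫₀¹ |∇²u|² dx₂⟩^{1/2}. -/

import Mathlib

noncomputable section
open MeasureTheory Filter Set
open scoped ENNReal

namespace RB


/-- A time-dependent scalar field: arguments t, x₁, x₂. -/
abbrev TField := ℝ → ℝ → ℝ → ℝ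
/-- A static scalar field: arguments x₁, x₂. -/
abbrev SField := ℝ → ℝ → ℝ

def tsmooth (f : TField) : Prop :=
  ContDiff ℝ (⊤ : ℕ∞) (fun q : ℝ × ℝ × ℝ => f q.1 q.2.1 q.2.2)
def ssmooth (f : SField) : Prop :=
  ContDiff ℝ (⊤ : ℕ∞) (fun q : ℝ × ℝ => f q.1 q.2)
def tperiodic (Γ : ℝ) (f : TField) : Prop := ∀ t x1 x2, f t (x1 + Γ) x2 = f t x1 x2
def speriodic (Γ : ℝ) (f : SField) : Prop := ∀ x1 x2, f (x1 + Γ) x2 = f x1 x2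

/-- time derivative -/
def dt (f : TField) : TField := fun t x1 x2 => deriv (fun s => f s x1 x2) t
/-- partial derivative in x₁ (time-dependent field) -/
def d1 (f : TField) : TField := fun t x1 x2 => deriv (fun y => f t y x2) x1
/-- partial derivative in x₂ (time-dependent field) -/
def d2 (f : TField) : TField := fun t x1 x2 => deriv (fun y => f t x1 y) x2
/-- partial derivative in x₁ (static field) -/
def q1 (f : SField) : SField := fun x1 x2 => deriv (fun y => f y x2) x1
/-- partial derivative in x₂ (static field) -/
def q2 (f : SField) : SField := fun x1 x2 => deriv (fun y => f x1 y) x2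

/-- Integral over Ω = [0,Γ]×[0,1]. -/
def intΩ (Γ : ℝ) (g : SField) : ℝ :=
  ∫ x1 in Ioc (0:ℝ) Γ, ∫ x2 in Ioc (0:ℝ) 1, g x1 x2

/-- Long-time horizontal average ⟨f⟩ of a quantity f(t, x₁). -/
def ltavg (Γ : ℝ) (f : ℝ → ℝ → ℝ) : ℝ :=
  limsup (fun t => (1/t) * ∫ s in Ioc (0:ℝ) t, (1/Γ) * ∫ x1 in Ioc (0:ℝ) Γ, f s x1) atTop

/-- spatial L² norm of a static scalar field over Ω -/
def sL2 (Γ : ℝ) (f : SField) : ℝ := Real.sqrt (intΩ Γ (fun x1 x2 => f x1 x2 ^ 2))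
/-- spatial L^r norm of a static scalar field over Ω -/
def sLr (Γ r : ℝ) (f : SField) : ℝ := (intΩ Γ (fun x1 x2 => |f x1 x2| ^ r)) ^ (1/r)
/-- H¹ norm of a static scalar field over Ω -/
def sH1 (Γ : ℝ) (f : SField) : ℝ :=
  Real.sqrt (intΩ Γ (fun x1 x2 => f x1 x2 ^ 2 + q1 f x1 x2 ^ 2 + q2 f x1 x2 ^ 2))

/-- A classical solution of the Boussinesq system on Ω = [0,Γ]×[0,1] with
Rayleigh number Ra, Prandtl number Pr, slip length Ls ∈ (0,∞]
(Navier-slip with friction coefficient `(Ls⁻¹).toReal`; for Ls = ∞ this is free-slip). -/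
structure Sol (Γ Ra Pr : ℝ) (Ls : ℝ≥0∞) where
  u1 : TField
  u2 : TField
  T : TField
  p : TField
  smooth_u1 : tsmooth u1
  smooth_u2 : tsmooth u2
  smooth_T : tsmooth T
  smooth_p : tsmooth p
  periodic_u1 : tperiodic Γ u1
  periodic_u2 : tperiodic Γ u2
  periodic_T : tperiodic Γ T
  periodic_p : tperiodic Γ p
  momentum1 : ∀ t x1 x2, 0 ≤ t → x2 ∈ Icc (0:ℝ) 1 →
    Pr⁻¹ * (dt u1 t x1 x2 + u1 t x1 x2 * d1 u1 t x1 x2 + u2 t x1 x2 * d2 u1 t x1 x2)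
      - (d1 (d1 u1) t x1 x2 + d2 (d2 u1) t x1 x2) + d1 p t x1 x2 = 0
  momentum2 : ∀ t x1 x2, 0 ≤ t → x2 ∈ Icc (0:ℝ) 1 →
    Pr⁻¹ * (dt u2 t x1 x2 + u1 t x1 x2 * d1 u2 t x1 x2 + u2 t x1 x2 * d2 u2 t x1 x2)
      - (d1 (d1 u2) t x1 x2 + d2 (d2 u2) t x1 x2) + d2 p t x1 x2 = Ra * T t x1 x2
  incomp : ∀ t x1 x2, 0 ≤ t → x2 ∈ Icc (0:ℝ) 1 →
    d1 u1 t x1 x2 + d2 u2 t x1 x2 = 0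
  heat : ∀ t x1 x2, 0 ≤ t → x2 ∈ Icc (0:ℝ) 1 →
    dt T t x1 x2 + u1 t x1 x2 * d1 T t x1 x2 + u2 t x1 x2 * d2 T t x1 x2
      - (d1 (d1 T) t x1 x2 + d2 (d2 T) t x1 x2) = 0
  T_bot : ∀ t x1, 0 ≤ t → T t x1 0 = 1
  T_top : ∀ t x1, 0 ≤ t → T t x1 1 = 0
  u2_bot : ∀ t x1, 0 ≤ t → u2 t x1 0 = 0
  u2_top : ∀ t x1, 0 ≤ t → u2 t x1 1 = 0
  slip_top : ∀ t x1, 0 ≤ t → d2 u1 t x1 1 = -(Ls⁻¹).toReal * u1 t x1 1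
  slip_bot : ∀ t x1, 0 ≤ t → d2 u1 t x1 0 = (Ls⁻¹).toReal * u1 t x1 0

variable {Γ Ra Pr : ℝ} {Ls : ℝ≥0∞}

/-- The Nusselt number Nu = ⟨∫₀¹ (u₂T − ∂₂T) dx₂⟩. -/
def Nu (S : Sol Γ Ra Pr Ls) : ℝ :=
  ltavg Γ (fun t x1 => ∫ x2 in (0:ℝ)..1, (S.u2 t x1 x2 * S.T t x1 x2 - d2 S.T t x1 x2))

/-- The initial temperature satisfies 0 ≤ T₀ ≤ 1 on Ω. -/
def T0cond (S : Sol Γ Ra Pr Ls) : Prop :=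
  ∀ x1 x2, x2 ∈ Icc (0:ℝ) 1 → S.T 0 x1 x2 ∈ Icc (0:ℝ) 1

/-- The vorticity ω = ∂₁u₂ − ∂₂u₁. -/
def vort (S : Sol Γ Ra Pr Ls) : TField :=
  fun t x1 x2 => d1 S.u2 t x1 x2 - d2 S.u1 t x1 x2

/-- |∇u|² pointwise. -/
def gradSq (S : Sol Γ Ra Pr Ls) : TField := fun t x1 x2 =>
  d1 S.u1 t x1 x2 ^ 2 + d2 S.u1 t x1 x2 ^ 2 + d1 S.u2 t x1 x2 ^ 2 + d2 S.u2 t x1 x2 ^ 2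

/-- |∇²u|² pointwise: sum of squares of all second spatial derivatives of u. -/
def hessSq (S : Sol Γ Ra Pr Ls) : TField := fun t x1 x2 =>
  d1 (d1 S.u1) t x1 x2 ^ 2 + d1 (d2 S.u1) t x1 x2 ^ 2 +
  d2 (d1 S.u1) t x1 x2 ^ 2 + d2 (d2 S.u1) t x1 x2 ^ 2 +
  d1 (d1 S.u2) t x1 x2 ^ 2 + d1 (d2 S.u2) t x1 x2 ^ 2 +
  d2 (d1 S.u2) t x1 x2 ^ 2 + d2 (d2 S.u2) t x1 x2 ^ 2

/-- ‖u(t)‖_{L²}. -/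
def uL2 (S : Sol Γ Ra Pr Ls) (t : ℝ) : ℝ :=
  Real.sqrt (intΩ Γ (fun x1 x2 => S.u1 t x1 x2 ^ 2 + S.u2 t x1 x2 ^ 2))

/-- ‖u₀‖_{W^{1,4}}. -/
def W14u0 (S : Sol Γ Ra Pr Ls) : ℝ :=
  (intΩ Γ (fun x1 x2 =>
    (S.u1 0 x1 x2 ^ 2 + S.u2 0 x1 x2 ^ 2) ^ 2 + (gradSq S 0 x1 x2) ^ 2)) ^ ((1:ℝ)/4)

/-- ‖ω(t)‖_{L⁴}. -/
def omegaL4 (S : Sol Γ Ra Pr Ls) (t : ℝ) : ℝ :=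
  (intΩ Γ (fun x1 x2 => vort S t x1 x2 ^ 4)) ^ ((1:ℝ)/4)



/-- Algebra of smooth functions, periodic in x₁. -/
def Alg (Γ : ℝ) : Subalgebra ℝ (ℝ × ℝ × ℝ → ℝ) where
  carrier := {f | ContDiff ℝ (⊤ : ℕ∞) f ∧ ∀ q : ℝ × ℝ × ℝ, f (q + (0, Γ, 0)) = f q}
  mul_mem' := fun {f g} hf hg => ⟨hf.1.mul hg.1, fun q => by
    simp only [Pi.mul_apply]; rw [hf.2, hg.2]⟩
  add_mem' := fun {f g} hf hg => ⟨hf.1.add hg.1, fun q => by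
    simp only [Pi.add_apply]; rw [hf.2, hg.2]⟩
  algebraMap_mem' := fun r => ⟨contDiff_const, fun q => rfl⟩


def ev (f : Alg Γ) (t x y : ℝ) : ℝ := f.1 (t, x, y)

def cst (Γ : ℝ) (r : ℝ) : Alg Γ := ⟨fun _ => r, contDiff_const, fun _ => rfl⟩
def X2 (Γ : ℝ) : Alg Γ := ⟨fun q => q.2.2, contDiff_snd.comp contDiff_snd, fun q => by simp⟩

def DD (v : ℝ × ℝ × ℝ) (f : Alg Γ) : Alg Γ :=
  ⟨fun q => fderiv ℝ f.1 q v, by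
    refine ⟨?_, fun q => ?_⟩
    · exact (f.2.1.fderiv_right (m := (⊤ : ℕ∞)) (by simp)).clm_apply contDiff_const
    · have h : (fun q => f.1 (q + (0, Γ, 0))) = f.1 := funext f.2.2
      have h2 := fderiv_comp_add_right (𝕜 := ℝ) (f := f.1) (x := q) ((0, Γ, 0) : ℝ × ℝ × ℝ)
      rw [h] at h2
      show fderiv ℝ f.1 (q + (0, Γ, 0)) v = _
      rw [← h2]⟩

lemma Alg.diff (f : Alg Γ) : Differentiable ℝ f.1 := f.2.1.differentiable (by simp)
lemma Alg.cont (f : Alg Γ) : Continuous f.1 := f.2.1.continuous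

lemma ev_add (f g : Alg Γ) (t x y) : ev (f + g) t x y = ev f t x y + ev g t x y := rfl
lemma ev_mul (f g : Alg Γ) (t x y) : ev (f * g) t x y = ev f t x y * ev g t x y := rfl
lemma ev_sub (f g : Alg Γ) (t x y) : ev (f - g) t x y = ev f t x y - ev g t x y := rfl
lemma ev_neg (f : Alg Γ) (t x y) : ev (-f) t x y = - ev f t x y := rfl
lemma ev_pow (f : Alg Γ) (n : ℕ) (t x y) : ev (f ^ n) t x y = ev f t x y ^ n := rfl
lemma ev_cst (r t x y : ℝ) : ev (cst Γ r) t x y = r := rfl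
lemma ev_X2 (t x y : ℝ) : ev (X2 Γ) t x y = y := rfl

lemma DD_add (v) (f g : Alg Γ) : DD v (f + g) = DD v f + DD v g := by
  apply Subtype.ext; funext q
  show fderiv ℝ (f.1 + g.1) q v = fderiv ℝ f.1 q v + fderiv ℝ g.1 q v
  rw [fderiv_add ((Alg.diff f) q) ((Alg.diff g) q)]; rfl
lemma DD_mul (v) (f g : Alg Γ) : DD v (f * g) = DD v f * g + f * DD v g := by
  apply Subtype.ext; funext q
  show fderiv ℝ (f.1 * g.1) q v = fderiv ℝ f.1 q v * g.1 q + f.1 q * fderiv ℝ g.1 q v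
  rw [fderiv_mul ((Alg.diff f) q) ((Alg.diff g) q)]; simp; ring
lemma DD_neg (v) (f : Alg Γ) : DD v (-f) = - DD v f := by
  apply Subtype.ext; funext q
  show fderiv ℝ (-f.1) q v = - fderiv ℝ f.1 q v
  rw [fderiv_neg]; rfl
lemma DD_sub (v) (f g : Alg Γ) : DD v (f - g) = DD v f - DD v g := by
  rw [sub_eq_add_neg, DD_add, DD_neg, ← sub_eq_add_neg]
lemma DD_cst (v) (r : ℝ) : DD v (cst Γ r) = 0 := by
  apply Subtype.ext; funext q
  show fderiv ℝ (fun _ => r) q v = 0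
  simp
lemma DD_sq (v) (f : Alg Γ) : DD v (f ^ 2) = cst Γ 2 * (f * DD v f) := by
  rw [pow_two, DD_mul]; apply Subtype.ext; funext q
  show ev _ q.1 q.2.1 q.2.2 = ev _ q.1 q.2.1 q.2.2
  simp only [ev_add, ev_mul, ev_cst]; ring
lemma DD_X2 (v : ℝ × ℝ × ℝ) : DD v (X2 Γ) = cst Γ v.2.2 := by
  apply Subtype.ext; funext q
  have : (X2 Γ).1 = ((ContinuousLinearMap.snd ℝ ℝ ℝ).comp (ContinuousLinearMap.snd ℝ ℝ (ℝ × ℝ)) : ℝ × ℝ × ℝ → ℝ) := rfl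
  show fderiv ℝ (X2 Γ).1 q v = v.2.2
  rw [this, ContinuousLinearMap.fderiv]; rfl
lemma DD_comm (v w) (f : Alg Γ) : DD v (DD w f) = DD w (DD v f) := by
  apply Subtype.ext; funext q
  have hd : DifferentiableAt ℝ (fderiv ℝ f.1) q :=
    ((f.2.1.fderiv_right (m := (⊤ : ℕ∞)) (by simp)).differentiable (by simp)) q
  have key : ∀ v w, fderiv ℝ (fun q => fderiv ℝ f.1 q w) q v = fderiv ℝ (fderiv ℝ f.1) q v w := by
    intro v w
    rw [fderiv_clm_apply hd (differentiableAt_const _)]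
    simp
  show fderiv ℝ (fun q => fderiv ℝ f.1 q w) q v = fderiv ℝ (fun q => fderiv ℝ f.1 q v) q w
  rw [key, key]
  have : IsSymmSndFDerivAt ℝ f.1 q := f.2.1.contDiffAt.isSymmSndFDerivAt (by simp only [minSmoothness_of_isRCLikeNormedField]; exact WithTop.coe_le_coe.2 le_top)
  exact this v w

def Dt (f : Alg Γ) : Alg Γ := DD (1, 0, 0) f
def D1 (f : Alg Γ) : Alg Γ := DD (0, 1, 0) f
def D2 (f : Alg Γ) : Alg Γ := DD (0, 0, 1) f

lemma hasDerivAt_t (f : Alg Γ) (t x y : ℝ) :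
    HasDerivAt (fun s => ev f s x y) (ev (Dt f) t x y) t := by
  have h : HasDerivAt (fun s : ℝ => (s, x, y)) ((1, 0, 0) : ℝ × ℝ × ℝ) t :=
    (hasDerivAt_id t).prodMk (hasDerivAt_const t (x, y))
  exact ((Alg.diff f) (t, x, y)).hasFDerivAt.comp_hasDerivAt t h
lemma hasDerivAt_1 (f : Alg Γ) (t x y : ℝ) :
    HasDerivAt (fun s => ev f t s y) (ev (D1 f) t x y) x := by
  have h : HasDerivAt (fun s : ℝ => (t, s, y)) ((0, 1, 0) : ℝ × ℝ × ℝ) x :=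
    (hasDerivAt_const x t).prodMk ((hasDerivAt_id x).prodMk (hasDerivAt_const x y))
  exact ((Alg.diff f) (t, x, y)).hasFDerivAt.comp_hasDerivAt x h
lemma hasDerivAt_2 (f : Alg Γ) (t x y : ℝ) :
    HasDerivAt (fun s => ev f t x s) (ev (D2 f) t x y) y := by
  have h : HasDerivAt (fun s : ℝ => (t, x, s)) ((0, 0, 1) : ℝ × ℝ × ℝ) y :=
    (hasDerivAt_const y t).prodMk ((hasDerivAt_const y x).prodMk (hasDerivAt_id y))
  exact ((Alg.diff f) (t, x, y)).hasFDerivAt.comp_hasDerivAt y h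

lemma dt_ev (f : Alg Γ) : dt (ev f) = ev (Dt f) := by
  funext t x y; exact (hasDerivAt_t f t x y).deriv
lemma d1_ev (f : Alg Γ) : d1 (ev f) = ev (D1 f) := by
  funext t x y; exact (hasDerivAt_1 f t x y).deriv
lemma d2_ev (f : Alg Γ) : d2 (ev f) = ev (D2 f) := by
  funext t x y; exact (hasDerivAt_2 f t x y).deriv

lemma ev_per (f : Alg Γ) (t x y : ℝ) : ev f t (x + Γ) y = ev f t x y := by
  have := f.2.2 (t, x, y); simpa [ev] using this

lemma ev_cont (f : Alg Γ) : Continuous (fun q : ℝ × ℝ × ℝ => ev f q.1 q.2.1 q.2.2) := Alg.cont f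

def toAlg {f : TField} (hf : tsmooth f) (hp : tperiodic Γ f) : Alg Γ :=
  ⟨fun q => f q.1 q.2.1 q.2.2, hf, fun q => by simpa using! hp q.1 q.2.1 q.2.2⟩
lemma ev_toAlg {f : TField} (hf : tsmooth f) (hp : tperiodic Γ f) : ev (toAlg hf hp) = f := rfl

/- derivative rules -/
lemma Dt_add (f g : Alg Γ) : Dt (f + g) = Dt f + Dt g := DD_add _ _ _
lemma D1_add (f g : Alg Γ) : D1 (f + g) = D1 f + D1 g := DD_add _ _ _
lemma D2_add (f g : Alg Γ) : D2 (f + g) = D2 f + D2 g := DD_add _ _ _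
lemma Dt_sub (f g : Alg Γ) : Dt (f - g) = Dt f - Dt g := DD_sub _ _ _
lemma D1_sub (f g : Alg Γ) : D1 (f - g) = D1 f - D1 g := DD_sub _ _ _
lemma D2_sub (f g : Alg Γ) : D2 (f - g) = D2 f - D2 g := DD_sub _ _ _
lemma Dt_neg (f : Alg Γ) : Dt (-f) = - Dt f := DD_neg _ _
lemma D1_neg (f : Alg Γ) : D1 (-f) = - D1 f := DD_neg _ _
lemma D2_neg (f : Alg Γ) : D2 (-f) = - D2 f := DD_neg _ _
lemma Dt_mul (f g : Alg Γ) : Dt (f * g) = Dt f * g + f * Dt g := DD_mul _ _ _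
lemma D1_mul (f g : Alg Γ) : D1 (f * g) = D1 f * g + f * D1 g := DD_mul _ _ _
lemma D2_mul (f g : Alg Γ) : D2 (f * g) = D2 f * g + f * D2 g := DD_mul _ _ _
lemma Dt_sq (f : Alg Γ) : Dt (f ^ 2) = cst Γ 2 * (f * Dt f) := DD_sq _ _
lemma D1_sq (f : Alg Γ) : D1 (f ^ 2) = cst Γ 2 * (f * D1 f) := DD_sq _ _
lemma D2_sq (f : Alg Γ) : D2 (f ^ 2) = cst Γ 2 * (f * D2 f) := DD_sq _ _
lemma Dt_cst (r) : Dt (cst Γ r) = cst Γ 0 := DD_cst _ _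
lemma D1_cst (r) : D1 (cst Γ r) = cst Γ 0 := DD_cst _ _
lemma D2_cst (r) : D2 (cst Γ r) = cst Γ 0 := DD_cst _ _
lemma Dt_X2 : Dt (X2 Γ) = cst Γ 0 := DD_X2 _
lemma D1_X2 : D1 (X2 Γ) = cst Γ 0 := DD_X2 _
lemma D2_X2 : D2 (X2 Γ) = cst Γ 1 := DD_X2 _
/- canonical order: Dt innermost, then D1, then D2 outermost ... -/
lemma D1_D2 (f : Alg Γ) : D1 (D2 f) = D2 (D1 f) := DD_comm _ _ _
lemma Dt_D1 (f : Alg Γ) : Dt (D1 f) = D1 (Dt f) := DD_comm _ _ _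
lemma Dt_D2 (f : Alg Γ) : Dt (D2 f) = D2 (Dt f) := DD_comm _ _ _

lemma swap_cont {F : ℝ → ℝ → ℝ} (hF : Continuous (fun q : ℝ × ℝ => F q.1 q.2)) (a b c d : ℝ) :
    ∫ x in a..b, ∫ y in c..d, F x y = ∫ y in c..d, ∫ x in a..b, F x y := by
  apply intervalIntegral_intervalIntegral_swap
  have : IntegrableOn (fun q : ℝ × ℝ => F q.1 q.2) (uIcc a b ×ˢ uIcc c d) :=
    hF.continuousOn.integrableOn_compact (isCompact_uIcc.prod isCompact_uIcc)
  exact this.mono_set (prod_mono uIoc_subset_uIcc uIoc_subset_uIcc)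

/-- integral over [0,Γ]×[0,d] at time t -/
def I (d t : ℝ) (f : Alg Γ) : ℝ := ∫ x in (0:ℝ)..Γ, ∫ y in (0:ℝ)..d, ev f t x y
/-- integral over the line x₂ = d -/
def Tr (d t : ℝ) (f : Alg Γ) : ℝ := ∫ x in (0:ℝ)..Γ, ev f t x d

lemma ev_cont' {X : Type*} [TopologicalSpace X] (f : Alg Γ) {a b c : X → ℝ} (ha : Continuous a)
    (hb : Continuous b) (hc : Continuous c) : Continuous (fun q => ev f (a q) (b q) (c q)) :=
  (ev_cont f).comp (ha.prodMk (hb.prodMk hc))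

lemma inner_cont (f : Alg Γ) (d : ℝ) :
    Continuous (fun q : ℝ × ℝ => ∫ y in (0:ℝ)..d, ev f q.1 q.2 y) := by
  apply intervalIntegral.continuous_parametric_intervalIntegral_of_continuous'
  exact ev_cont' f (by fun_prop) (by fun_prop) (by fun_prop)

lemma inner_ii (f : Alg Γ) (t x a b : ℝ) : IntervalIntegrable (fun y => ev f t x y) volume a b :=
  (ev_cont' f (by fun_prop) (by fun_prop) (by fun_prop)).intervalIntegrable _ _
lemma tr_ii (f : Alg Γ) (t d a b : ℝ) : IntervalIntegrable (fun x => ev f t x d) volume a b :=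
  (ev_cont' f (by fun_prop) (by fun_prop) (by fun_prop)).intervalIntegrable _ _
lemma outer_ii (f : Alg Γ) (d t a b : ℝ) :
    IntervalIntegrable (fun x => ∫ y in (0:ℝ)..d, ev f t x y) volume a b :=
  ((inner_cont f d).comp (f := fun x : ℝ => (t, x)) (by fun_prop)).intervalIntegrable _ _

lemma I_add (d t) (f g : Alg Γ) : I d t (f + g) = I d t f + I d t g := by
  unfold I
  rw [← intervalIntegral.integral_add (outer_ii f d t _ _) (outer_ii g d t _ _)]
  congr 1; funext x
  rw [← intervalIntegral.integral_add (inner_ii f t x _ _) (inner_ii g t x _ _)]; rfl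
lemma I_cmul (d t r) (f : Alg Γ) : I d t (cst Γ r * f) = r * I d t f := by
  unfold I
  simp only [ev_mul, ev_cst, intervalIntegral.integral_const_mul]
lemma I_neg (d t) (f : Alg Γ) : I d t (-f) = - I d t f := by
  unfold I
  simp only [ev_neg, intervalIntegral.integral_neg]
lemma I_sub (d t) (f g : Alg Γ) : I d t (f - g) = I d t f - I d t g := by
  rw [sub_eq_add_neg, I_add, I_neg, ← sub_eq_add_neg]
lemma I_cst (d t r) : I d t (cst Γ r) = Γ * d * r := by
  unfold I; simp [ev_cst]; ring

lemma Tr_add (d t) (f g : Alg Γ) : Tr d t (f + g) = Tr d t f + Tr d t g :=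
  intervalIntegral.integral_add (tr_ii f t d _ _) (tr_ii g t d _ _)
lemma Tr_cmul (d t r) (f : Alg Γ) : Tr d t (cst Γ r * f) = r * Tr d t f := by
  unfold Tr
  simp only [ev_mul, ev_cst, intervalIntegral.integral_const_mul]
lemma Tr_congr {d t} {f g : Alg Γ} (h : ∀ x, ev f t x d = ev g t x d) : Tr d t f = Tr d t g := by
  unfold Tr; congr 1; funext x; exact h x
lemma Tr_D1 (d t) (f : Alg Γ) : Tr d t (D1 f) = 0 := by
  unfold Tr
  rw [intervalIntegral.integral_eq_sub_of_hasDerivAt (fun x _ => hasDerivAt_1 f t x d)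
    (tr_ii _ _ _ _ _)]
  have := ev_per f t 0 d
  rw [zero_add] at this; rw [this, sub_self]
lemma Tr_nonneg (hΓ : 0 < Γ) {d t} {f : Alg Γ} (h : ∀ x, 0 ≤ ev f t x d) : 0 ≤ Tr d t f :=
  intervalIntegral.integral_nonneg hΓ.le (fun x _ => h x)

lemma I_mono (hΓ : 0 < Γ) {d t : ℝ} (hd : 0 ≤ d) {f g : Alg Γ}
    (h : ∀ x y, y ∈ Ioo 0 d → ev f t x y ≤ ev g t x y) : I d t f ≤ I d t g := by
  apply intervalIntegral.integral_mono_on hΓ.le (outer_ii f d t _ _) (outer_ii g d t _ _)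
  intro x _
  exact intervalIntegral.integral_mono_on_of_le_Ioo hd (inner_ii f t x _ _) (inner_ii g t x _ _)
    (fun y hy => h x y hy)
lemma I_congr (hΓ : 0 < Γ) {d t : ℝ} (hd : 0 ≤ d) {f g : Alg Γ}
    (h : ∀ x y, y ∈ Ioo 0 d → ev f t x y = ev g t x y) : I d t f = I d t g :=
  le_antisymm (I_mono hΓ hd fun x y hy => (h x y hy).le)
    (I_mono hΓ hd fun x y hy => (h x y hy).ge)
lemma I_nonneg (hΓ : 0 < Γ) {d t : ℝ} (hd : 0 ≤ d) {f : Alg Γ}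
    (h : ∀ x y, y ∈ Ioo 0 d → 0 ≤ ev f t x y) : 0 ≤ I d t f := by
  have := I_mono hΓ hd (f := cst Γ 0) (g := f) (t := t) h
  rwa [I_cst, mul_zero] at this

lemma I_swap (d t) (f : Alg Γ) : I d t f = ∫ y in (0:ℝ)..d, ∫ x in (0:ℝ)..Γ, ev f t x y :=
  swap_cont (ev_cont' f (by fun_prop) (by fun_prop) (by fun_prop)) _ _ _ _

lemma I_D1 (d t) (f : Alg Γ) : I d t (D1 f) = 0 := by
  rw [I_swap]
  have : ∀ y, ∫ x in (0:ℝ)..Γ, ev (D1 f) t x y = 0 := fun y => Tr_D1 y t f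
  simp [this]
lemma I_D2 (d t) (f : Alg Γ) : I d t (D2 f) = Tr d t f - Tr 0 t f := by
  unfold I Tr
  rw [← intervalIntegral.integral_sub (tr_ii _ _ _ _ _) (tr_ii _ _ _ _ _)]
  congr 1; funext x
  exact intervalIntegral.integral_eq_sub_of_hasDerivAt (fun y _ => hasDerivAt_2 f t x y)
    (inner_ii _ _ _ _ _)

lemma I_cont (d) (f : Alg Γ) : Continuous (fun t => I d t f) := by
  apply intervalIntegral.continuous_parametric_intervalIntegral_of_continuous'
  exact inner_cont f d

lemma I_diff (d t) (f : Alg Γ) : I d t f = I d 0 f + ∫ s in (0:ℝ)..t, I d s (Dt f) := by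
  have h1 : ∫ s in (0:ℝ)..t, I d s (Dt f)
      = ∫ x in (0:ℝ)..Γ, ∫ y in (0:ℝ)..d, ∫ s in (0:ℝ)..t, ev (Dt f) s x y := by
    unfold I
    rw [swap_cont (inner_cont (Dt f) d)]
    congr 1; funext x
    exact swap_cont (F := fun s y => ev (Dt f) s x y) (ev_cont' _ (by fun_prop) (by fun_prop) (by fun_prop)) _ _ _ _
  have h2 : ∀ x y, ∫ s in (0:ℝ)..t, ev (Dt f) s x y = ev f t x y - ev f 0 x y := fun x y =>
    intervalIntegral.integral_eq_sub_of_hasDerivAt (fun s _ => hasDerivAt_t f s x y)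
      ((ev_cont' (Dt f) (by fun_prop) (by fun_prop) (by fun_prop)).intervalIntegrable _ _)
  rw [h1]; simp only [h2]
  unfold I
  rw [← intervalIntegral.integral_add (outer_ii f d 0 _ _)]
  · congr 1; funext x
    rw [intervalIntegral.integral_sub (inner_ii _ _ _ _ _) (inner_ii _ _ _ _ _)]; ring
  · have := (outer_ii f d t 0 Γ).sub (outer_ii f d 0 0 Γ)
    convert this using 2
    rw [intervalIntegral.integral_sub (inner_ii _ _ _ _ _) (inner_ii _ _ _ _ _)]

lemma I_hasDerivAt (d t) (f : Alg Γ) : HasDerivAt (fun t => I d t f) (I d t (Dt f)) t := by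
  have : (fun t => I d t f) = fun t => I d 0 f + ∫ s in (0:ℝ)..t, I d s (Dt f) :=
    funext fun t => I_diff d t f
  rw [this]
  exact ((I_cont d (Dt f)).integral_hasStrictDerivAt 0 t).hasDerivAt.const_add _

/-- optimisation lemma -/
lemma opt {X B C : ℝ} (hB : 0 ≤ B) (hC : 0 ≤ C) (h : ∀ s : ℝ, 0 < s → X ≤ s * B + C / s) :
    X ≤ 2 * (√B * √C) := by
  have hb := Real.sq_sqrt hB
  have hc := Real.sq_sqrt hC
  set β := √B
  set γ := √C
  have hβ : 0 ≤ β := Real.sqrt_nonneg _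
  have hγ : 0 ≤ γ := Real.sqrt_nonneg _
  apply le_of_forall_pos_le_add
  intro ε hε
  set e := ε / (β + γ + 1)
  have he : 0 < e := by positivity
  have h1 := h ((γ + e) / (β + e)) (by positivity)
  have h2 : (γ + e) / (β + e) * B ≤ (γ + e) * β := by
    rw [div_mul_eq_mul_div, div_le_iff₀ (by positivity), ← hb]
    nlinarith [mul_nonneg hβ hγ, mul_nonneg (mul_nonneg he.le hβ) hγ, mul_nonneg (mul_nonneg he.le hβ) he.le]
  have h3 : C / ((γ + e) / (β + e)) ≤ γ * (β + e) := by
    rw [div_div_eq_mul_div, div_le_iff₀ (by positivity), ← hc]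
    nlinarith [mul_nonneg hβ hγ, mul_nonneg (mul_nonneg he.le hβ) hγ, mul_nonneg (mul_nonneg he.le hγ) he.le]
  have h4 : e * (β + γ + 1) = ε := by
    simp only [e]; field_simp
  nlinarith

/-- Young -/
lemma young (a b : ℝ) {s : ℝ} (hs : 0 < s) : 2 * |a * b| ≤ s * a ^ 2 + b ^ 2 / s := by
  have h : 0 ≤ (s * |a| - |b|) ^ 2 / s := by positivity
  have : (s * |a| - |b|) ^ 2 / s = s * a ^ 2 + b ^ 2 / s - 2 * |a * b| := by
    rw [← sq_abs a, ← sq_abs b, abs_mul]; field_simp; ring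
  linarith

lemma second_test {f f' : ℝ → ℝ} {f'' x : ℝ} (h1 : ∀ y, HasDerivAt f (f' y) y)
    (h2 : HasDerivAt f' f'' x) (hm : IsLocalMax f x) : f'' ≤ 0 := by
  by_contra hc
  push Not at hc
  have hd : deriv f = f' := funext fun y => (h1 y).deriv
  have h0 : deriv f x = 0 := hm.deriv_eq_zero
  have hmin : IsLocalMin f x := by
    apply isLocalMin_of_deriv_deriv_pos _ h0 (h1 x).continuousAt
    rw [hd, h2.deriv]; exact hc
  have hcst : f =ᶠ[nhds x] fun _ => f x := by
    filter_upwards [hm, hmin] with y hy1 hy2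
    exact le_antisymm hy1 hy2
  have h3 : deriv f =ᶠ[nhds x] deriv (fun _ => f x) := hcst.deriv
  have h4 := h3.deriv_eq
  rw [hd, h2.deriv] at h4
  simp at h4
  linarith

lemma maxprinciple (hΓ : 0 < Γ) (a b f : Alg Γ)
    (heq : ∀ t x y, 0 ≤ t → y ∈ Icc (0:ℝ) 1 → ev (Dt f) t x y + ev a t x y * ev (D1 f) t x y
      + ev b t x y * ev (D2 f) t x y - (ev (D1 (D1 f)) t x y + ev (D2 (D2 f)) t x y) = 0)
    (h0 : ∀ x y, y ∈ Icc (0:ℝ) 1 → ev f 0 x y ≤ 1)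
    (hb : ∀ t x, 0 ≤ t → ev f t x 0 ≤ 1) (ht : ∀ t x, 0 ≤ t → ev f t x 1 ≤ 1)
    (t x y : ℝ) (htt : 0 ≤ t) (hy : y ∈ Icc (0:ℝ) 1) : ev f t x y ≤ 1 := by
  -- reduction to x in [0,Γ]
  have per : ∀ s x y : ℝ, ∃ x' ∈ Icc (0:ℝ) Γ, ∀ s y : ℝ, ev f s x y = ev f s x' y := by
    intro s x y
    refine ⟨toIcoMod hΓ 0 x, ?_, ?_⟩
    · have := toIcoMod_mem_Ico hΓ 0 x
      rw [zero_add] at this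
      exact Ico_subset_Icc_self this
    · intro s y
      have hp : Function.Periodic (fun x => ev f s x y) Γ := fun x => ev_per f s x y
      have := hp.sub_zsmul_eq (x := x) (toIcoDiv hΓ 0 x)
      rw [toIcoMod]; exact this.symm
  have main : ∀ ε : ℝ, 0 < ε → ev f t x y - ε * t ≤ 1 := by
    intro ε hε
    have hK : IsCompact (Icc (0:ℝ) t ×ˢ (Icc (0:ℝ) Γ ×ˢ Icc (0:ℝ) 1)) :=
      isCompact_Icc.prod (isCompact_Icc.prod isCompact_Icc)
    have hgc : Continuous (fun q : ℝ × ℝ × ℝ => ev f q.1 q.2.1 q.2.2 - ε * q.1) :=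
      (ev_cont f).sub (by fun_prop)
    obtain ⟨⟨s, x0, y0⟩, ⟨hs, hx0, hy0⟩, hmax⟩ := hK.exists_isMaxOn
      ⟨(0, 0, 0), ⟨by simp [htt], by simp [hΓ.le], by simp⟩⟩ hgc.continuousOn
    simp only at hs hx0 hy0
    have hM : ∀ s' x' y', s' ∈ Icc (0:ℝ) t → y' ∈ Icc (0:ℝ) 1 →
        ev f s' x' y' - ε * s' ≤ ev f s x0 y0 - ε * s := by
      intro s' x' y' hs' hy'
      obtain ⟨x'', hx'', he⟩ := per s' x' y'
      rw [he]
      exact hmax (show (s', x'', y') ∈ _ from ⟨hs', hx'', hy'⟩)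
    refine (hM t x y ⟨htt, le_rfl⟩ hy).trans ?_
    have hes : 0 ≤ ε * s := mul_nonneg hε.le hs.1
    rcases hs.1.eq_or_lt with h | hs0
    · rw [← h]; have := h0 x0 y0 hy0; linarith
    rcases hy0.1.eq_or_lt with h | hy00
    · rw [← h]; have := hb s x0 hs.1; linarith
    rcases hy0.2.eq_or_lt with h | hy01
    · rw [h]; have := ht s x0 hs.1; linarith
    exfalso
    have hm1 : IsLocalMax (fun x' => ev f s x' y0) x0 := Eventually.of_forall fun x' => by
      have := hM s x' y0 hs hy0
      simp only; linarith
    have hm2 : IsLocalMax (fun y' => ev f s x0 y') y0 := by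
      filter_upwards [Ioo_mem_nhds hy00 hy01] with y' hy'
      have := hM s x0 y' hs (Ioo_subset_Icc_self hy')
      linarith
    have e1 : ev (D1 f) s x0 y0 = 0 := by
      rw [← (hasDerivAt_1 f s x0 y0).deriv]; exact hm1.deriv_eq_zero
    have e2 : ev (D2 f) s x0 y0 = 0 := by
      rw [← (hasDerivAt_2 f s x0 y0).deriv]; exact hm2.deriv_eq_zero
    have e11 := second_test (fun x' => hasDerivAt_1 f s x' y0) (hasDerivAt_1 (D1 f) s x0 y0) hm1
    have e22 := second_test (fun y' => hasDerivAt_2 f s x0 y') (hasDerivAt_2 (D2 f) s x0 y0) hm2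
    have et : ε ≤ ev (Dt f) s x0 y0 := by
      have hd : HasDerivAt (fun s' => ev f s' x0 y0 - ε * s') (ev (Dt f) s x0 y0 - ε) s := by
        have := (hasDerivAt_t f s x0 y0).sub ((hasDerivAt_id s).const_mul ε)
        simpa using! this
      have hw := hd.hasDerivWithinAt (s := Iio s)
      rw [hasDerivWithinAt_iff_tendsto_slope' (by simp)] at hw
      have : 0 ≤ ev (Dt f) s x0 y0 - ε := by
        refine ge_of_tendsto hw ?_
        filter_upwards [Ioo_mem_nhdsLT hs0] with s' hs'
        rw [slope_def_field]
        have := hM s' x0 y0 ⟨hs'.1.le, hs'.2.le.trans hs.2⟩ hy0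
        apply div_nonneg_of_nonpos
        · linarith
        · linarith [hs'.2]
      linarith
    have := heq s x0 y0 hs.1 hy0
    rw [e1, e2] at this
    linarith
  apply le_of_forall_pos_le_add
  intro ε hε
  have := main (ε / (t + 1)) (by positivity)
  have h2 : ε / (t + 1) * t ≤ ε := by
    rw [div_mul_eq_mul_div, div_le_iff₀ (by positivity)]; nlinarith
  linarith

set_option linter.unusedSimpArgs false
/-- the solution data as elements of the algebra -/
structure Sys (Γ Ra κ β : ℝ) where
  a : Alg Γ
  b : Alg Γ
  T : Alg Γ
  p : Alg Γ
  hΓ : 0 < Γ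
  hRa : 0 < Ra
  hκ : 0 < κ
  hβ : 0 ≤ β
  m1 : ∀ t x y, 0 ≤ t → y ∈ Icc (0:ℝ) 1 →
    κ * (ev (Dt a) t x y + ev a t x y * ev (D1 a) t x y + ev b t x y * ev (D2 a) t x y)
      - (ev (D1 (D1 a)) t x y + ev (D2 (D2 a)) t x y) + ev (D1 p) t x y = 0
  m2 : ∀ t x y, 0 ≤ t → y ∈ Icc (0:ℝ) 1 →
    κ * (ev (Dt b) t x y + ev a t x y * ev (D1 b) t x y + ev b t x y * ev (D2 b) t x y)
      - (ev (D1 (D1 b)) t x y + ev (D2 (D2 b)) t x y) + ev (D2 p) t x y = Ra * ev T t x y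
  inc : ∀ t x y, 0 ≤ t → y ∈ Icc (0:ℝ) 1 → ev (D1 a) t x y + ev (D2 b) t x y = 0
  heat : ∀ t x y, 0 ≤ t → y ∈ Icc (0:ℝ) 1 → ev (Dt T) t x y + ev a t x y * ev (D1 T) t x y
      + ev b t x y * ev (D2 T) t x y - (ev (D1 (D1 T)) t x y + ev (D2 (D2 T)) t x y) = 0
  Tbot : ∀ t x, 0 ≤ t → ev T t x 0 = 1
  Ttop : ∀ t x, 0 ≤ t → ev T t x 1 = 0
  bbot : ∀ t x, 0 ≤ t → ev b t x 0 = 0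
  btop : ∀ t x, 0 ≤ t → ev b t x 1 = 0
  sltop : ∀ t x, 0 ≤ t → ev (D2 a) t x 1 = -β * ev a t x 1
  sbot : ∀ t x, 0 ≤ t → ev (D2 a) t x 0 = β * ev a t x 0
  T01 : ∀ t x y, 0 ≤ t → y ∈ Icc (0:ℝ) 1 → 0 ≤ ev T t x y ∧ ev T t x y ≤ 1

lemma D1_zero {f : Alg Γ} {t y : ℝ} (h : ∀ x, ev f t x y = 0) (x : ℝ) : ev (D1 f) t x y = 0 := by
  rw [← (hasDerivAt_1 f t x y).deriv]
  have : (fun s => ev f t s y) = fun _ => 0 := funext h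
  rw [this]; simp
lemma Dt_zero {f : Alg Γ} {x y : ℝ} (h : ∀ t, 0 ≤ t → ev f t x y = 0) (t : ℝ) (ht : 0 < t) :
    ev (Dt f) t x y = 0 := by
  rw [← (hasDerivAt_t f t x y).deriv]
  have : (fun s => ev f s x y) =ᶠ[nhds t] fun _ => 0 := by
    filter_upwards [Ioi_mem_nhds ht] with s hs
    exact h s (le_of_lt hs)
  rw [this.deriv_eq]; simp
lemma D2_zero {f : Alg Γ} {t x : ℝ} (h : ∀ y, y ∈ Icc (0:ℝ) 1 → ev f t x y = 0) (y : ℝ)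
    (hy : y ∈ Ioo (0:ℝ) 1) : ev (D2 f) t x y = 0 := by
  rw [← (hasDerivAt_2 f t x y).deriv]
  have : (fun s => ev f t x s) =ᶠ[nhds y] fun _ => 0 := by
    filter_upwards [Ioo_mem_nhds hy.1 hy.2] with s hs
    exact h s (Ioo_subset_Icc_self hs)
  rw [this.deriv_eq]; simp

section
variable {κ β : ℝ} (S : Sys Γ Ra κ β)
namespace Sys

lemma inc1 (t x y : ℝ) (ht : 0 ≤ t) (hy : y ∈ Icc (0:ℝ) 1) :
    ev (D1 (D1 S.a)) t x y + ev (D2 (D1 S.b)) t x y = 0 := by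
  have := D1_zero (f := D1 S.a + D2 S.b) (t := t) (y := y) (fun x => S.inc t x y ht hy) x
  rwa [D1_add, D1_D2, ev_add] at this
lemma inc2 (t x y : ℝ) (ht : 0 ≤ t) (hy : y ∈ Ioo (0:ℝ) 1) :
    ev (D2 (D1 S.a)) t x y + ev (D2 (D2 S.b)) t x y = 0 := by
  have := D2_zero (f := D1 S.a + D2 S.b) (t := t) (x := x) (fun y hy => S.inc t x y ht hy) y hy
  rwa [D2_add, ev_add] at this
lemma inct (t x y : ℝ) (ht : 0 < t) (hy : y ∈ Icc (0:ℝ) 1) :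
    ev (D1 (Dt S.a)) t x y + ev (D2 (Dt S.b)) t x y = 0 := by
  have := Dt_zero (f := D1 S.a + D2 S.b) (x := x) (y := y) (fun t ht => S.inc t x y ht hy) t ht
  rwa [Dt_add, Dt_D1, Dt_D2, ev_add] at this
lemma b1bot (t x : ℝ) (ht : 0 ≤ t) : ev (D1 S.b) t x 0 = 0 :=
  D1_zero (fun x => S.bbot t x ht) x
lemma b1top (t x : ℝ) (ht : 0 ≤ t) : ev (D1 S.b) t x 1 = 0 :=
  D1_zero (fun x => S.btop t x ht) x
lemma btbot (t x : ℝ) (ht : 0 < t) : ev (Dt S.b) t x 0 = 0 :=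
  Dt_zero (fun t ht => S.bbot t x ht) t ht
lemma bttop (t x : ℝ) (ht : 0 < t) : ev (Dt S.b) t x 1 = 0 :=
  Dt_zero (fun t ht => S.btop t x ht) t ht
lemma s1top (t x : ℝ) (ht : 0 ≤ t) : ev (D2 (D1 S.a)) t x 1 = -β * ev (D1 S.a) t x 1 := by
  have := D1_zero (f := D2 S.a + cst Γ β * S.a) (t := t) (y := 1) (fun x => by
    simp only [ev_add, ev_mul, ev_cst, S.sltop t x ht]; ring) x
  rw [D1_add, D1_mul, D1_cst, D1_D2] at this
  simp only [ev_add, ev_mul, ev_cst] at this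
  linarith
lemma s1bot (t x : ℝ) (ht : 0 ≤ t) : ev (D2 (D1 S.a)) t x 0 = β * ev (D1 S.a) t x 0 := by
  have := D1_zero (f := D2 S.a - cst Γ β * S.a) (t := t) (y := 0) (fun x => by
    simp only [ev_sub, ev_mul, ev_cst, S.sbot t x ht]; ring) x
  rw [D1_sub, D1_mul, D1_cst, D1_D2] at this
  simp only [ev_sub, ev_add, ev_mul, ev_cst] at this
  linarith

def G : Alg Γ := D1 S.a ^ 2 + D2 S.a ^ 2 + D1 S.b ^ 2 + D2 S.b ^ 2
def q : Alg Γ := S.a ^ 2 + S.b ^ 2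
def La : Alg Γ := D1 (D1 S.a) + D2 (D2 S.a)
def Lb : Alg Γ := D1 (D1 S.b) + D2 (D2 S.b)
def LL : Alg Γ := S.La ^ 2 + S.Lb ^ 2
def HH : Alg Γ := D1 (D1 S.a) ^ 2 + cst Γ 2 * D2 (D1 S.a) ^ 2 + D2 (D2 S.a) ^ 2
  + D1 (D1 S.b) ^ 2 + cst Γ 2 * D2 (D1 S.b) ^ 2 + D2 (D2 S.b) ^ 2
def N1 : Alg Γ := S.a * D1 S.a + S.b * D2 S.a
def N2 : Alg Γ := S.a * D1 S.b + S.b * D2 S.b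
def om : Alg Γ := D1 S.b - D2 S.a

end Sys

def phi (Γ : ℝ) : Alg Γ := cst Γ 2 * X2 Γ - cst Γ 1

/-- boundary integral -/
def B (t : ℝ) (f : Alg Γ) : ℝ := Tr 1 t f + Tr 0 t f

lemma B_eq (t : ℝ) (f : Alg Γ) : I 1 t (D2 (phi Γ * f)) = B t f := by
  rw [I_D2]
  have h1 : Tr 1 t (phi Γ * f) = Tr 1 t f := Tr_congr fun x => by
    simp only [phi, ev_mul, ev_sub, ev_cst, ev_X2]; ring
  have h0 : Tr 0 t (phi Γ * f) = Tr 0 t (cst Γ (-1) * f) := Tr_congr fun x => by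
    simp only [phi, ev_mul, ev_sub, ev_cst, ev_X2]; ring
  rw [h1, h0, Tr_cmul, B]; ring

lemma B_hasDerivAt (t : ℝ) (f : Alg Γ) : HasDerivAt (fun t => B t f) (B t (Dt f)) t := by
  have : (fun t => B t f) = fun t => I 1 t (D2 (phi Γ * f)) := funext fun t => (B_eq t f).symm
  rw [this]
  convert I_hasDerivAt 1 t (D2 (phi Γ * f)) using 1
  rw [Dt_D2, Dt_mul, ← B_eq]
  have : Dt (phi Γ) = 0 := by
    rw [phi, Dt_sub, Dt_mul, Dt_cst, Dt_cst, Dt_X2]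
    apply Subtype.ext; funext q
    show ev _ q.1 q.2.1 q.2.2 = 0
    simp only [ev_sub, ev_add, ev_mul, ev_cst]; ring
  rw [this, zero_mul, zero_add]

lemma B_sq_nonneg (hΓ : 0 < Γ) (t) (f : Alg Γ) : 0 ≤ B t (f ^ 2) :=
  add_nonneg (Tr_nonneg hΓ fun x => by rw [ev_pow]; positivity)
    (Tr_nonneg hΓ fun x => by rw [ev_pow]; positivity)

namespace Sys

/-- energy identity -/
lemma E1 (t : ℝ) (ht : 0 ≤ t) :
    κ / 2 * I 1 t (Dt S.q) + I 1 t S.G + β * B t (S.a ^ 2) = Ra * I 1 t (S.T * S.b) := by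
  have h : I 1 t (cst Γ (κ / 2) * Dt S.q + S.G
      + D1 (cst Γ (κ / 2) * (S.a * S.q) - S.a * D1 S.a - S.b * D1 S.b + S.a * S.p)
      + D2 (cst Γ (κ / 2) * (S.b * S.q) - S.a * D2 S.a - S.b * D2 S.b + S.b * S.p))
      = I 1 t (cst Γ Ra * (S.T * S.b)) := by
    refine I_congr S.hΓ zero_le_one fun x y hy => ?_
    have hy' := Ioo_subset_Icc_self hy
    simp only [q, G, D1_D2, Dt_D1, Dt_D2, Dt_add, D1_add, D2_add, Dt_sub, D1_sub, D2_sub, Dt_neg, D1_neg, D2_neg, Dt_mul, D1_mul, D2_mul,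
      Dt_sq, D1_sq, D2_sq, Dt_cst, D1_cst, D2_cst, Dt_X2, D1_X2, D2_X2, ev_add, ev_sub, ev_neg, ev_mul, ev_pow, ev_cst, ev_X2]
    linear_combination (ev S.a t x y) * S.m1 t x y ht hy' + (ev S.b t x y) * S.m2 t x y ht hy' +
      (κ / 2 * (ev S.a t x y ^ 2 + ev S.b t x y ^ 2) + ev S.p t x y) * S.inc t x y ht hy'
  simp only [I_add, I_cmul, I_D1, I_D2] at h
  have h1 : Tr 1 t (cst Γ (κ / 2) * (S.b * S.q) - S.a * D2 S.a - S.b * D2 S.b + S.b * S.p)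
      = Tr 1 t (cst Γ β * S.a ^ 2) := Tr_congr fun x => by
    simp only [D1_D2, Dt_D1, Dt_D2, Dt_add, D1_add, D2_add, Dt_sub, D1_sub, D2_sub, Dt_neg, D1_neg, D2_neg, Dt_mul, D1_mul, D2_mul,
      Dt_sq, D1_sq, D2_sq, Dt_cst, D1_cst, D2_cst, Dt_X2, D1_X2, D2_X2, ev_add, ev_sub, ev_neg, ev_mul, ev_pow, ev_cst, ev_X2, S.btop t x ht, S.sltop t x ht]; ring
  have h0 : Tr 0 t (cst Γ (κ / 2) * (S.b * S.q) - S.a * D2 S.a - S.b * D2 S.b + S.b * S.p)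
      = Tr 0 t (cst Γ (-β) * S.a ^ 2) := Tr_congr fun x => by
    simp only [D1_D2, Dt_D1, Dt_D2, Dt_add, D1_add, D2_add, Dt_sub, D1_sub, D2_sub, Dt_neg, D1_neg, D2_neg, Dt_mul, D1_mul, D2_mul,
      Dt_sq, D1_sq, D2_sq, Dt_cst, D1_cst, D2_cst, Dt_X2, D1_X2, D2_X2, ev_add, ev_sub, ev_neg, ev_mul, ev_pow, ev_cst, ev_X2, S.bbot t x ht, S.sbot t x ht]; ring
  rw [h1, h0, Tr_cmul, Tr_cmul] at h
  rw [B]; linarith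

/-- ∫ |∇u|² + β∫_∂ a² = -∫ u·Δu -/
lemma E0 (t : ℝ) (ht : 0 ≤ t) :
    I 1 t S.G + β * B t (S.a ^ 2) = I 1 t (-(S.a * S.La + S.b * S.Lb)) := by
  have h : I 1 t (S.G + D1 (-(S.a * D1 S.a) - S.b * D1 S.b)
      + D2 (-(S.a * D2 S.a) - S.b * D2 S.b)) = I 1 t (-(S.a * S.La + S.b * S.Lb)) := by
    refine I_congr S.hΓ zero_le_one fun x y hy => ?_
    simp only [G, La, Lb, D1_D2, Dt_D1, Dt_D2, Dt_add, D1_add, D2_add, Dt_sub, D1_sub, D2_sub, Dt_neg, D1_neg, D2_neg, Dt_mul, D1_mul, D2_mul,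
      Dt_sq, D1_sq, D2_sq, Dt_cst, D1_cst, D2_cst, Dt_X2, D1_X2, D2_X2, ev_add, ev_sub, ev_neg, ev_mul, ev_pow, ev_cst, ev_X2]
    ring
  simp only [I_add, I_D1, I_D2] at h
  have h1 : Tr 1 t (-(S.a * D2 S.a) - S.b * D2 S.b)
      = Tr 1 t (cst Γ β * S.a ^ 2) := Tr_congr fun x => by
    simp only [D1_D2, Dt_D1, Dt_D2, Dt_add, D1_add, D2_add, Dt_sub, D1_sub, D2_sub, Dt_neg, D1_neg, D2_neg, Dt_mul, D1_mul, D2_mul,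
      Dt_sq, D1_sq, D2_sq, Dt_cst, D1_cst, D2_cst, Dt_X2, D1_X2, D2_X2, ev_add, ev_sub, ev_neg, ev_mul, ev_pow, ev_cst, ev_X2, S.btop t x ht, S.sltop t x ht]; ring
  have h0 : Tr 0 t (-(S.a * D2 S.a) - S.b * D2 S.b)
      = Tr 0 t (cst Γ (-β) * S.a ^ 2) := Tr_congr fun x => by
    simp only [D1_D2, Dt_D1, Dt_D2, Dt_add, D1_add, D2_add, Dt_sub, D1_sub, D2_sub, Dt_neg, D1_neg, D2_neg, Dt_mul, D1_mul, D2_mul,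
      Dt_sq, D1_sq, D2_sq, Dt_cst, D1_cst, D2_cst, Dt_X2, D1_X2, D2_X2, ev_add, ev_sub, ev_neg, ev_mul, ev_pow, ev_cst, ev_X2, S.bbot t x ht, S.sbot t x ht]; ring
  rw [h1, h0, Tr_cmul, Tr_cmul] at h
  rw [B]; linarith

/-- ∫|D²u|² ≤ ∫|Δu|² -/
lemma HL (t : ℝ) (ht : 0 ≤ t) : I 1 t S.HH ≤ I 1 t S.LL := by
  have h : I 1 t (S.HH + cst Γ 2 * D1 (D1 S.a * D2 (D2 S.a) + D1 S.b * D2 (D2 S.b))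
      + cst Γ 2 * D2 (-(D1 S.a * D2 (D1 S.a) + D1 S.b * D2 (D1 S.b)))) = I 1 t S.LL := by
    refine I_congr S.hΓ zero_le_one fun x y hy => ?_
    simp only [HH, LL, La, Lb, D1_D2, Dt_D1, Dt_D2, Dt_add, D1_add, D2_add, Dt_sub, D1_sub, D2_sub, Dt_neg, D1_neg, D2_neg, Dt_mul, D1_mul, D2_mul,
      Dt_sq, D1_sq, D2_sq, Dt_cst, D1_cst, D2_cst, Dt_X2, D1_X2, D2_X2, ev_add, ev_sub, ev_neg, ev_mul, ev_pow, ev_cst, ev_X2]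
    ring
  simp only [I_add, I_cmul, I_D1, I_D2] at h
  have h1 : Tr 1 t (-(D1 S.a * D2 (D1 S.a) + D1 S.b * D2 (D1 S.b)))
      = Tr 1 t (cst Γ β * D1 S.a ^ 2) := Tr_congr fun x => by
    simp only [D1_D2, Dt_D1, Dt_D2, Dt_add, D1_add, D2_add, Dt_sub, D1_sub, D2_sub, Dt_neg, D1_neg, D2_neg, Dt_mul, D1_mul, D2_mul,
      Dt_sq, D1_sq, D2_sq, Dt_cst, D1_cst, D2_cst, Dt_X2, D1_X2, D2_X2, ev_add, ev_sub, ev_neg, ev_mul, ev_pow, ev_cst, ev_X2, S.b1top t x ht, S.s1top t x ht]; ring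
  have h0 : Tr 0 t (-(D1 S.a * D2 (D1 S.a) + D1 S.b * D2 (D1 S.b)))
      = Tr 0 t (cst Γ (-β) * D1 S.a ^ 2) := Tr_congr fun x => by
    simp only [D1_D2, Dt_D1, Dt_D2, Dt_add, D1_add, D2_add, Dt_sub, D1_sub, D2_sub, Dt_neg, D1_neg, D2_neg, Dt_mul, D1_mul, D2_mul,
      Dt_sq, D1_sq, D2_sq, Dt_cst, D1_cst, D2_cst, Dt_X2, D1_X2, D2_X2, ev_add, ev_sub, ev_neg, ev_mul, ev_pow, ev_cst, ev_X2, S.b1bot t x ht, S.s1bot t x ht]; ring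
  rw [h1, h0, Tr_cmul, Tr_cmul] at h
  have := mul_nonneg S.hβ (B_sq_nonneg S.hΓ t (D1 S.a))
  rw [B] at this; linarith

def w1 : Alg Γ := cst Γ 2 * S.a + phi Γ * D2 S.a
def w2 : Alg Γ := -(phi Γ * D1 S.a)

/-- time derivative of the H¹ energy -/
def Yt (t : ℝ) : ℝ := I 1 t (Dt S.G) + β * B t (Dt (S.a ^ 2))

/-- test with u_t: preliminary -/
lemma Yt_eq (t : ℝ) (ht : 0 < t) :
    S.Yt t = 2 * I 1 t (-(Dt S.a * S.La + Dt S.b * S.Lb)) := by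
  have h : I 1 t (Dt S.G + cst Γ 2 * D1 (-(Dt S.a * D1 S.a) - Dt S.b * D1 S.b)
      + cst Γ 2 * D2 (-(Dt S.a * D2 S.a) - Dt S.b * D2 S.b))
      = I 1 t (cst Γ 2 * -(Dt S.a * S.La + Dt S.b * S.Lb)) := by
    refine I_congr S.hΓ zero_le_one fun x y hy => ?_
    simp only [G, La, Lb, D1_D2, Dt_D1, Dt_D2, Dt_add, D1_add, D2_add, Dt_sub, D1_sub, D2_sub, Dt_neg, D1_neg, D2_neg, Dt_mul, D1_mul, D2_mul,
      Dt_sq, D1_sq, D2_sq, Dt_cst, D1_cst, D2_cst, Dt_X2, D1_X2, D2_X2, ev_add, ev_sub, ev_neg, ev_mul, ev_pow, ev_cst, ev_X2]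
    ring
  simp only [I_add, I_cmul, I_D1, I_D2] at h
  have h1 : Tr 1 t (-(Dt S.a * D2 S.a) - Dt S.b * D2 S.b)
      = Tr 1 t (cst Γ (β / 2) * Dt (S.a ^ 2)) := Tr_congr fun x => by
    simp only [D1_D2, Dt_D1, Dt_D2, Dt_add, D1_add, D2_add, Dt_sub, D1_sub, D2_sub, Dt_neg, D1_neg, D2_neg, Dt_mul, D1_mul, D2_mul,
      Dt_sq, D1_sq, D2_sq, Dt_cst, D1_cst, D2_cst, Dt_X2, D1_X2, D2_X2, ev_add, ev_sub, ev_neg, ev_mul, ev_pow, ev_cst, ev_X2, S.bttop t x ht, S.sltop t x ht.le]; ring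
  have h0 : Tr 0 t (-(Dt S.a * D2 S.a) - Dt S.b * D2 S.b)
      = Tr 0 t (cst Γ (-β / 2) * Dt (S.a ^ 2)) := Tr_congr fun x => by
    simp only [D1_D2, Dt_D1, Dt_D2, Dt_add, D1_add, D2_add, Dt_sub, D1_sub, D2_sub, Dt_neg, D1_neg, D2_neg, Dt_mul, D1_mul, D2_mul,
      Dt_sq, D1_sq, D2_sq, Dt_cst, D1_cst, D2_cst, Dt_X2, D1_X2, D2_X2, ev_add, ev_sub, ev_neg, ev_mul, ev_pow, ev_cst, ev_X2, S.btbot t x ht, S.sbot t x ht.le]; ring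
  rw [h1, h0, Tr_cmul, Tr_cmul] at h
  rw [Yt, B]; linarith

/-- test with u_t -/
lemma E3 (t : ℝ) (ht : 0 < t) :
    κ * I 1 t (Dt S.a ^ 2 + Dt S.b ^ 2) + κ * I 1 t (S.N1 * Dt S.a + S.N2 * Dt S.b)
      + 1 / 2 * S.Yt t = Ra * I 1 t (S.T * Dt S.b) := by
  have h : I 1 t (cst Γ κ * (Dt S.a ^ 2 + Dt S.b ^ 2) + cst Γ κ * (S.N1 * Dt S.a + S.N2 * Dt S.b)
      + -(Dt S.a * S.La + Dt S.b * S.Lb) + D1 (Dt S.a * S.p) + D2 (Dt S.b * S.p))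
      = I 1 t (cst Γ Ra * (S.T * Dt S.b)) := by
    refine I_congr S.hΓ zero_le_one fun x y hy => ?_
    have hy' := Ioo_subset_Icc_self hy
    simp only [N1, N2, La, Lb, D1_D2, Dt_D1, Dt_D2, Dt_add, D1_add, D2_add, Dt_sub, D1_sub, D2_sub, Dt_neg, D1_neg, D2_neg, Dt_mul, D1_mul, D2_mul,
      Dt_sq, D1_sq, D2_sq, Dt_cst, D1_cst, D2_cst, Dt_X2, D1_X2, D2_X2, ev_add, ev_sub, ev_neg, ev_mul, ev_pow, ev_cst, ev_X2]
    linear_combination (ev (Dt S.a) t x y) * S.m1 t x y ht.le hy'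
      + (ev (Dt S.b) t x y) * S.m2 t x y ht.le hy'
      + ev S.p t x y * S.inct t x y ht hy'
  have h1 : Tr 1 t (Dt S.b * S.p) = Tr 1 t (cst Γ 0 * S.p) := Tr_congr fun x => by
    simp only [D1_D2, Dt_D1, Dt_D2, Dt_add, D1_add, D2_add, Dt_sub, D1_sub, D2_sub, Dt_neg, D1_neg, D2_neg, Dt_mul, D1_mul, D2_mul,
      Dt_sq, D1_sq, D2_sq, Dt_cst, D1_cst, D2_cst, Dt_X2, D1_X2, D2_X2, ev_add, ev_sub, ev_neg, ev_mul, ev_pow, ev_cst, ev_X2, S.bttop t x ht]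
  have h0 : Tr 0 t (Dt S.b * S.p) = Tr 0 t (cst Γ 0 * S.p) := Tr_congr fun x => by
    simp only [D1_D2, Dt_D1, Dt_D2, Dt_add, D1_add, D2_add, Dt_sub, D1_sub, D2_sub, Dt_neg, D1_neg, D2_neg, Dt_mul, D1_mul, D2_mul,
      Dt_sq, D1_sq, D2_sq, Dt_cst, D1_cst, D2_cst, Dt_X2, D1_X2, D2_X2, ev_add, ev_sub, ev_neg, ev_mul, ev_pow, ev_cst, ev_X2, S.btbot t x ht]
  simp only [I_add, I_cmul, I_D1, I_D2] at h ⊢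
  rw [h1, h0, Tr_cmul, Tr_cmul] at h
  rw [S.Yt_eq t ht]; linarith

/-- the nonlinear term vanishes against Δu -/
lemma NL (t : ℝ) (ht : 0 ≤ t) : I 1 t (S.N1 * S.La + S.N2 * S.Lb) = 0 := by
  have h : I 1 t (S.N1 * S.La + S.N2 * S.Lb) = I 1 t (
      D1 (S.N2 * S.om) - D2 (S.N1 * S.om)
      - cst Γ (1 / 2) * (D1 (S.a * S.om ^ 2) + D2 (S.b * S.om ^ 2))) := by
    refine I_congr S.hΓ zero_le_one fun x y hy => ?_
    have hy' := Ioo_subset_Icc_self hy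
    simp only [N1, N2, La, Lb, om, D1_D2, Dt_D1, Dt_D2, Dt_add, D1_add, D2_add, Dt_sub, D1_sub, D2_sub, Dt_neg, D1_neg, D2_neg, Dt_mul, D1_mul, D2_mul,
      Dt_sq, D1_sq, D2_sq, Dt_cst, D1_cst, D2_cst, Dt_X2, D1_X2, D2_X2, ev_add, ev_sub, ev_neg, ev_mul, ev_pow, ev_cst, ev_X2]
    have i0 := S.inc t x y ht hy'
    have i1 := S.inc1 t x y ht hy'
    have i2 := S.inc2 t x y ht hy
    have e0 : ev (D2 S.b) t x y = - ev (D1 S.a) t x y := by linarith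
    have e1 : ev (D2 (D1 S.b)) t x y = - ev (D1 (D1 S.a)) t x y := by linarith
    have e2 : ev (D2 (D2 S.b)) t x y = - ev (D2 (D1 S.a)) t x y := by linarith
    rw [e0, e1, e2]
    ring
  simp only [I_add, I_sub, I_cmul, I_D1, I_D2] at h
  have h1 : Tr 1 t (S.N1 * S.om) = Tr 1 t (D1 (cst Γ (β / 3) * (S.a * S.a ^ 2))) :=
    Tr_congr fun x => by
    simp only [N1, om, D1_D2, Dt_D1, Dt_D2, Dt_add, D1_add, D2_add, Dt_sub, D1_sub, D2_sub, Dt_neg, D1_neg, D2_neg, Dt_mul, D1_mul, D2_mul,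
      Dt_sq, D1_sq, D2_sq, Dt_cst, D1_cst, D2_cst, Dt_X2, D1_X2, D2_X2, ev_add, ev_sub, ev_neg, ev_mul, ev_pow, ev_cst, ev_X2, S.btop t x ht, S.b1top t x ht, S.sltop t x ht]; ring
  have h0 : Tr 0 t (S.N1 * S.om) = Tr 0 t (D1 (cst Γ (-β / 3) * (S.a * S.a ^ 2))) :=
    Tr_congr fun x => by
    simp only [N1, om, D1_D2, Dt_D1, Dt_D2, Dt_add, D1_add, D2_add, Dt_sub, D1_sub, D2_sub, Dt_neg, D1_neg, D2_neg, Dt_mul, D1_mul, D2_mul,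
      Dt_sq, D1_sq, D2_sq, Dt_cst, D1_cst, D2_cst, Dt_X2, D1_X2, D2_X2, ev_add, ev_sub, ev_neg, ev_mul, ev_pow, ev_cst, ev_X2, S.bbot t x ht, S.b1bot t x ht, S.sbot t x ht]; ring
  have h3 : Tr 1 t (S.b * S.om ^ 2) = Tr 1 t (cst Γ 0 * S.p) := Tr_congr fun x => by
    simp only [D1_D2, Dt_D1, Dt_D2, Dt_add, D1_add, D2_add, Dt_sub, D1_sub, D2_sub, Dt_neg, D1_neg, D2_neg, Dt_mul, D1_mul, D2_mul,
      Dt_sq, D1_sq, D2_sq, Dt_cst, D1_cst, D2_cst, Dt_X2, D1_X2, D2_X2, ev_add, ev_sub, ev_neg, ev_mul, ev_pow, ev_cst, ev_X2, S.btop t x ht]; ring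
  have h4 : Tr 0 t (S.b * S.om ^ 2) = Tr 0 t (cst Γ 0 * S.p) := Tr_congr fun x => by
    simp only [D1_D2, Dt_D1, Dt_D2, Dt_add, D1_add, D2_add, Dt_sub, D1_sub, D2_sub, Dt_neg, D1_neg, D2_neg, Dt_mul, D1_mul, D2_mul,
      Dt_sq, D1_sq, D2_sq, Dt_cst, D1_cst, D2_cst, Dt_X2, D1_X2, D2_X2, ev_add, ev_sub, ev_neg, ev_mul, ev_pow, ev_cst, ev_X2, S.bbot t x ht]; ring
  rw [h1, h0, h3, h4, Tr_D1, Tr_D1, Tr_cmul, Tr_cmul] at h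
  rw [I_add]; linarith

/-- the pressure against Δu -/
lemma PL (t : ℝ) (ht : 0 ≤ t) : I 1 t (-(D1 S.p * S.La + D2 S.p * S.Lb))
    = β * I 1 t (S.w1 * D1 S.p + S.w2 * D2 S.p) := by
  have h : I 1 t (-(D1 S.p * S.La + D2 S.p * S.Lb)) = I 1 t (
      D2 (D1 S.p * S.om) - D1 (D2 S.p * S.om)) := by
    refine I_congr S.hΓ zero_le_one fun x y hy => ?_
    have hy' := Ioo_subset_Icc_self hy
    simp only [La, Lb, om, D1_D2, Dt_D1, Dt_D2, Dt_add, D1_add, D2_add, Dt_sub, D1_sub, D2_sub, Dt_neg, D1_neg, D2_neg, Dt_mul, D1_mul, D2_mul,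
      Dt_sq, D1_sq, D2_sq, Dt_cst, D1_cst, D2_cst, Dt_X2, D1_X2, D2_X2, ev_add, ev_sub, ev_neg, ev_mul, ev_pow, ev_cst, ev_X2]
    linear_combination (-ev (D1 S.p) t x y) * S.inc1 t x y ht hy'
      - (ev (D2 S.p) t x y) * S.inc2 t x y ht hy
  simp only [I_sub, I_D1, I_D2] at h
  have h1 : Tr 1 t (D1 S.p * S.om) = Tr 1 t (cst Γ β * (S.a * D1 S.p)) := Tr_congr fun x => by
    simp only [om, D1_D2, Dt_D1, Dt_D2, Dt_add, D1_add, D2_add, Dt_sub, D1_sub, D2_sub, Dt_neg, D1_neg, D2_neg, Dt_mul, D1_mul, D2_mul,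
      Dt_sq, D1_sq, D2_sq, Dt_cst, D1_cst, D2_cst, Dt_X2, D1_X2, D2_X2, ev_add, ev_sub, ev_neg, ev_mul, ev_pow, ev_cst, ev_X2, S.b1top t x ht, S.sltop t x ht]; ring
  have h0 : Tr 0 t (D1 S.p * S.om) = Tr 0 t (cst Γ (-β) * (S.a * D1 S.p)) := Tr_congr fun x => by
    simp only [om, D1_D2, Dt_D1, Dt_D2, Dt_add, D1_add, D2_add, Dt_sub, D1_sub, D2_sub, Dt_neg, D1_neg, D2_neg, Dt_mul, D1_mul, D2_mul,
      Dt_sq, D1_sq, D2_sq, Dt_cst, D1_cst, D2_cst, Dt_X2, D1_X2, D2_X2, ev_add, ev_sub, ev_neg, ev_mul, ev_pow, ev_cst, ev_X2, S.b1bot t x ht, S.sbot t x ht]; ring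
  rw [h1, h0, Tr_cmul, Tr_cmul] at h
  have hB : B t (S.a * D1 S.p) = I 1 t (S.w1 * D1 S.p + S.w2 * D2 S.p) := by
    rw [← B_eq]
    have : I 1 t (D2 (phi Γ * (S.a * D1 S.p))) = I 1 t (S.w1 * D1 S.p + S.w2 * D2 S.p
        + D1 (phi Γ * (S.a * D2 S.p))) := by
      refine I_congr S.hΓ zero_le_one fun x y hy => ?_
      simp only [w1, w2, phi, D1_D2, Dt_D1, Dt_D2, Dt_add, D1_add, D2_add, Dt_sub, D1_sub, D2_sub, Dt_neg, D1_neg, D2_neg, Dt_mul, D1_mul, D2_mul,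
      Dt_sq, D1_sq, D2_sq, Dt_cst, D1_cst, D2_cst, Dt_X2, D1_X2, D2_X2, ev_add, ev_sub, ev_neg, ev_mul, ev_pow, ev_cst, ev_X2]
      ring
    rw [this, I_add, I_D1, add_zero]
  rw [← hB, h, B]; ring

/-- test with -Δu -/
lemma E2 (t : ℝ) (ht : 0 < t) :
    κ / 2 * S.Yt t + I 1 t S.LL + β * I 1 t (S.w1 * D1 S.p + S.w2 * D2 S.p)
      = - Ra * I 1 t (S.T * S.Lb) := by
  have h : I 1 t (cst Γ κ * -(Dt S.a * S.La + Dt S.b * S.Lb) + S.LL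
      + cst Γ (-κ) * (S.N1 * S.La + S.N2 * S.Lb) + -(D1 S.p * S.La + D2 S.p * S.Lb))
      = I 1 t (cst Γ (-Ra) * (S.T * S.Lb)) := by
    refine I_congr S.hΓ zero_le_one fun x y hy => ?_
    have hy' := Ioo_subset_Icc_self hy
    have e1 := S.m1 t x y ht.le hy'
    have e2 := S.m2 t x y ht.le hy'
    simp only [N1, N2, LL, La, Lb, D1_D2, Dt_D1, Dt_D2, Dt_add, D1_add, D2_add, Dt_sub, D1_sub, D2_sub, Dt_neg, D1_neg, D2_neg, Dt_mul, D1_mul, D2_mul,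
      Dt_sq, D1_sq, D2_sq, Dt_cst, D1_cst, D2_cst, Dt_X2, D1_X2, D2_X2, ev_add, ev_sub, ev_neg, ev_mul, ev_pow, ev_cst, ev_X2]
    linear_combination (-(ev (D1 (D1 S.a)) t x y + ev (D2 (D2 S.a)) t x y)) * e1
      - (ev (D1 (D1 S.b)) t x y + ev (D2 (D2 S.b)) t x y) * e2
  have hP := S.PL t ht.le
  simp only [I_add, I_cmul, I_neg] at h hP ⊢
  have hN := S.NL t ht.le
  have hY := S.Yt_eq t ht
  simp only [I_add, I_neg] at hN hY
  rw [hY]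
  linear_combination h - hP + κ * hN


end Sys
end

set_option linter.unusedSimpArgs false
lemma ode_bound {E E' : ℝ → ℝ} {k c : ℝ} (hk : 0 ≤ k) (hE : ∀ t, HasDerivAt E (E' t) t)
    (h : ∀ t, 0 ≤ t → E' t ≤ k * (c - E t)) (t : ℝ) (ht : 0 ≤ t) : E t ≤ max c (E 0) := by
  have hd : ∀ t, HasDerivAt (fun t => (E t - c) * Real.exp (k * t))
      (E' t * Real.exp (k * t) + (E t - c) * (Real.exp (k * t) * (k * 1))) t := fun t =>
    ((hE t).sub_const c).mul (((hasDerivAt_id t).const_mul k).exp)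
  have hanti : AntitoneOn (fun t => (E t - c) * Real.exp (k * t)) (Ici 0) := by
    apply antitoneOn_of_deriv_nonpos (convex_Ici 0)
    · exact fun t _ => (hd t).continuousAt.continuousWithinAt
    · exact fun t _ => (hd t).differentiableAt.differentiableWithinAt
    · intro t ht
      rw [interior_Ici] at ht
      rw [(hd t).deriv]
      have := h t (le_of_lt ht)
      have he := Real.exp_pos (k * t)
      nlinarith
  have := hanti self_mem_Ici ht ht
  simp only [mul_zero, Real.exp_zero, mul_one] at this
  by_contra hcon
  push Not at hcon
  obtain ⟨h1, h2⟩ := max_lt_iff.1 hcon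
  have he : 1 ≤ Real.exp (k * t) := Real.one_le_exp (by positivity)
  nlinarith

lemma avg_bound {F F' g : ℝ → ℝ} {C : ℝ} (hF : ∀ t, HasDerivAt F (F' t) t) (hg : Continuous g)
    (hF0 : ∀ t, 0 ≤ t → 0 ≤ F t) (h : ∀ t, 0 < t → F' t + g t ≤ C) (t : ℝ) (ht : 0 ≤ t) :
    ∫ s in (0:ℝ)..t, g s ≤ C * t + F 0 := by
  have hd : ∀ t, HasDerivAt (fun t => F t + (∫ s in (0:ℝ)..t, g s) - C * t)
      (F' t + g t - C * 1) t := fun t =>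
    ((hF t).add (hg.integral_hasStrictDerivAt 0 t).hasDerivAt).sub ((hasDerivAt_id t).const_mul C)
  have hanti : AntitoneOn (fun t => F t + (∫ s in (0:ℝ)..t, g s) - C * t) (Ici 0) := by
    apply antitoneOn_of_deriv_nonpos (convex_Ici 0)
    · exact fun t _ => (hd t).continuousAt.continuousWithinAt
    · exact fun t _ => (hd t).differentiableAt.differentiableWithinAt
    · intro t ht
      rw [interior_Ici] at ht
      rw [(hd t).deriv]
      have := h t ht
      linarith
  have := hanti self_mem_Ici ht ht
  simp only [intervalIntegral.integral_same, mul_zero] at this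
  have := hF0 t ht
  linarith

section
variable {κ β : ℝ} (S : Sys Γ Ra κ β)
namespace Sys

lemma I_sq_nonneg (t : ℝ) (f : Alg Γ) (hΓ : 0 < Γ) : 0 ≤ I 1 t (f ^ 2) :=
  I_nonneg hΓ zero_le_one fun x y _ => by rw [ev_pow]; positivity

lemma poinc_b (t : ℝ) (ht : 0 ≤ t) : I 1 t (S.b ^ 2) ≤ I 1 t (D2 S.b ^ 2) := by
  have h : B t (S.b ^ 2) = 0 := by
    have h1 : Tr 1 t (S.b ^ 2) = Tr 1 t (cst Γ 0 * S.b) := Tr_congr fun x => by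
      simp only [D1_D2, Dt_D1, Dt_D2, Dt_add, D1_add, D2_add, Dt_sub, D1_sub, D2_sub, Dt_neg, D1_neg, D2_neg, Dt_mul, D1_mul, D2_mul,
      Dt_sq, D1_sq, D2_sq, Dt_cst, D1_cst, D2_cst, Dt_X2, D1_X2, D2_X2, ev_add, ev_sub, ev_neg, ev_mul, ev_pow, ev_cst, ev_X2, S.btop t x ht]; ring
    have h0 : Tr 0 t (S.b ^ 2) = Tr 0 t (cst Γ 0 * S.b) := Tr_congr fun x => by
      simp only [D1_D2, Dt_D1, Dt_D2, Dt_add, D1_add, D2_add, Dt_sub, D1_sub, D2_sub, Dt_neg, D1_neg, D2_neg, Dt_mul, D1_mul, D2_mul,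
      Dt_sq, D1_sq, D2_sq, Dt_cst, D1_cst, D2_cst, Dt_X2, D1_X2, D2_X2, ev_add, ev_sub, ev_neg, ev_mul, ev_pow, ev_cst, ev_X2, S.bbot t x ht]; ring
    rw [B, h1, h0, Tr_cmul, Tr_cmul]; ring
  rw [← B_eq] at h
  have : I 1 t (S.b ^ 2) ≤ I 1 t (D2 S.b ^ 2 + D2 (phi Γ * S.b ^ 2)) := by
    refine I_mono S.hΓ zero_le_one fun x y hy => ?_
    simp only [phi, D1_D2, Dt_D1, Dt_D2, Dt_add, D1_add, D2_add, Dt_sub, D1_sub, D2_sub, Dt_neg, D1_neg, D2_neg, Dt_mul, D1_mul, D2_mul,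
      Dt_sq, D1_sq, D2_sq, Dt_cst, D1_cst, D2_cst, Dt_X2, D1_X2, D2_X2, ev_add, ev_sub, ev_neg, ev_mul, ev_pow, ev_cst, ev_X2]
    nlinarith [sq_nonneg ((2 * y - 1) * ev S.b t x y + ev (D2 S.b) t x y),
      mul_nonneg (mul_nonneg hy.1.le (sub_nonneg.2 hy.2.le)) (sq_nonneg (ev S.b t x y))]
  rw [I_add, h] at this; linarith

lemma poinc_a (t : ℝ) : I 1 t (S.a ^ 2) ≤ B t (S.a ^ 2) + I 1 t (D2 S.a ^ 2) := by
  have : I 1 t (S.a ^ 2) ≤ I 1 t (D2 S.a ^ 2 + D2 (phi Γ * S.a ^ 2)) := by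
    refine I_mono S.hΓ zero_le_one fun x y hy => ?_
    simp only [phi, D1_D2, Dt_D1, Dt_D2, Dt_add, D1_add, D2_add, Dt_sub, D1_sub, D2_sub, Dt_neg, D1_neg, D2_neg, Dt_mul, D1_mul, D2_mul,
      Dt_sq, D1_sq, D2_sq, Dt_cst, D1_cst, D2_cst, Dt_X2, D1_X2, D2_X2, ev_add, ev_sub, ev_neg, ev_mul, ev_pow, ev_cst, ev_X2]
    nlinarith [sq_nonneg ((2 * y - 1) * ev S.a t x y + ev (D2 S.a) t x y),
      mul_nonneg (mul_nonneg hy.1.le (sub_nonneg.2 hy.2.le)) (sq_nonneg (ev S.a t x y))]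
  rw [I_add, B_eq] at this; linarith

lemma G_parts (t : ℝ) : I 1 t (D1 S.a ^ 2) + I 1 t (D2 S.a ^ 2) + I 1 t (D1 S.b ^ 2)
    + I 1 t (D2 S.b ^ 2) = I 1 t S.G := by rw [G]; simp only [I_add]

lemma b_le_G (t : ℝ) (ht : 0 ≤ t) : I 1 t (S.b ^ 2) ≤ I 1 t S.G := by
  have := S.poinc_b t ht
  have := S.G_parts t
  have := I_sq_nonneg t (D1 S.a) S.hΓ
  have := I_sq_nonneg t (D2 S.a) S.hΓ
  have := I_sq_nonneg t (D1 S.b) S.hΓ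
  linarith

lemma q_le (t : ℝ) (ht : 0 ≤ t) : I 1 t S.q ≤ B t (S.a ^ 2) + I 1 t S.G := by
  have := S.poinc_b t ht
  have := S.poinc_a t
  have := S.G_parts t
  have := I_sq_nonneg t (D1 S.a) S.hΓ
  have := I_sq_nonneg t (D1 S.b) S.hΓ
  rw [q, I_add]
  linarith

lemma G_nonneg (t : ℝ) : 0 ≤ I 1 t S.G := I_nonneg S.hΓ zero_le_one fun x y _ => by
  simp only [G, ev_add, ev_pow]; positivity
lemma q_nonneg (t : ℝ) : 0 ≤ I 1 t S.q := I_nonneg S.hΓ zero_le_one fun x y _ => by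
  simp only [q, ev_add, ev_pow]; positivity
lemma LL_nonneg (t : ℝ) : 0 ≤ I 1 t S.LL := I_nonneg S.hΓ zero_le_one fun x y _ => by
  simp only [LL, ev_add, ev_pow]; positivity
lemma HH_nonneg (t : ℝ) : 0 ≤ I 1 t S.HH := I_nonneg S.hΓ zero_le_one fun x y _ => by
  simp only [HH, ev_add, ev_pow, ev_mul, ev_cst]; positivity

lemma energy (t : ℝ) (ht : 0 ≤ t) :
    κ / 2 * I 1 t (Dt S.q) + 1 / 2 * I 1 t S.G + β * B t (S.a ^ 2) ≤ 1 / 2 * Ra ^ 2 * Γ := by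
  have h := S.E1 t ht
  have h1 : I 1 t (cst Γ Ra * (S.T * S.b)) ≤ I 1 t (cst Γ (1/2) * S.b ^ 2 + cst Γ (1/2 * Ra ^ 2)) := by
    refine I_mono S.hΓ zero_le_one fun x y hy => ?_
    simp only [D1_D2, Dt_D1, Dt_D2, Dt_add, D1_add, D2_add, Dt_sub, D1_sub, D2_sub, Dt_neg, D1_neg, D2_neg, Dt_mul, D1_mul, D2_mul,
      Dt_sq, D1_sq, D2_sq, Dt_cst, D1_cst, D2_cst, Dt_X2, D1_X2, D2_X2, ev_add, ev_sub, ev_neg, ev_mul, ev_pow, ev_cst, ev_X2]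
    obtain ⟨h0, h1⟩ := S.T01 t x y ht (Ioo_subset_Icc_self hy)
    have : ev S.T t x y ^ 2 ≤ 1 := by nlinarith
    nlinarith [sq_nonneg (Ra * ev S.T t x y - ev S.b t x y), mul_nonneg (sq_nonneg Ra) (sub_nonneg.2 this)]
  rw [I_cmul, I_add, I_cmul, I_cst] at h1
  have := S.b_le_G t ht
  linarith

/-- ∫₀ᵗ ‖∇u‖² grows at most linearly -/
lemma G_avg : ∃ C D : ℝ, 0 ≤ C ∧ 0 ≤ D ∧ ∀ t, 0 ≤ t → ∫ s in (0:ℝ)..t, I 1 s S.G ≤ C * t + D := by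
  refine ⟨Ra ^ 2 * Γ, κ * I 1 0 S.q, by have := S.hΓ; positivity,
    mul_nonneg S.hκ.le (S.q_nonneg 0), fun t ht => ?_⟩
  refine avg_bound (F := fun t => κ * I 1 t S.q) (fun t => (I_hasDerivAt 1 t S.q).const_mul κ)
    (I_cont 1 S.G) (fun t _ => mul_nonneg S.hκ.le (S.q_nonneg t)) (fun t ht => ?_) t ht
  have := S.energy t ht.le
  have := mul_nonneg S.hβ (B_sq_nonneg S.hΓ t S.a)
  linarith

/-- uniform energy bound for β > 0 -/
lemma q_bdd (hb : 0 < β) : ∃ M : ℝ, 0 ≤ M ∧ ∀ t, 0 ≤ t → I 1 t S.q ≤ M := by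
  set c := min (1/2) β with hc
  have hc0 : 0 < c := lt_min (by norm_num) hb
  have hκ := S.hκ
  refine ⟨_, ?_, ode_bound (k := 2 * c / κ) (c := Ra ^ 2 * Γ / (2 * c)) (by positivity)
    (fun t => I_hasDerivAt 1 t S.q) (fun t ht => ?_)⟩
  · exact le_max_of_le_right (S.q_nonneg 0)
  · have h1 := S.energy t ht
    have h2 := S.q_le t ht
    have h3 := S.G_nonneg t
    have h4 := B_sq_nonneg S.hΓ t S.a
    have h5 : c * I 1 t S.G ≤ 1/2 * I 1 t S.G := mul_le_mul_of_nonneg_right (min_le_left _ _) h3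
    have h6 : c * B t (S.a ^ 2) ≤ β * B t (S.a ^ 2) :=
      mul_le_mul_of_nonneg_right (min_le_right _ _) h4
    have h7 := mul_le_mul_of_nonneg_left h2 hc0.le
    have e : 2 * c / κ * (Ra ^ 2 * Γ / (2 * c) - I 1 t S.q)
      = (Ra ^ 2 * Γ - 2 * c * I 1 t S.q) / κ := by field_simp
    rw [e, le_div_iff₀ hκ]
    linarith

def th : Alg Γ := S.T - cst Γ 1 + X2 Γ

/-- temperature identity -/
lemma Temp (t : ℝ) (ht : 0 ≤ t) : 1 / 2 * I 1 t (Dt (S.th ^ 2)) + I 1 t (D1 S.T ^ 2 + D2 S.T ^ 2)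
    = Γ + I 1 t (S.b * S.th) := by
  have h : I 1 t (cst Γ (1/2) * Dt (S.th ^ 2) + (D1 S.T ^ 2 + D2 S.T ^ 2)
      + D1 (cst Γ (1/2) * (S.a * S.th ^ 2) - D1 S.T * S.th)
      + D2 (cst Γ (1/2) * (S.b * S.th ^ 2) - D2 S.T * S.th))
      = I 1 t (D2 (-S.T) + S.b * S.th) := by
    refine I_congr S.hΓ zero_le_one fun x y hy => ?_
    have hy' := Ioo_subset_Icc_self hy
    simp only [th, D1_D2, Dt_D1, Dt_D2, Dt_add, D1_add, D2_add, Dt_sub, D1_sub, D2_sub, Dt_neg, D1_neg, D2_neg, Dt_mul, D1_mul, D2_mul,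
      Dt_sq, D1_sq, D2_sq, Dt_cst, D1_cst, D2_cst, Dt_X2, D1_X2, D2_X2, ev_add, ev_sub, ev_neg, ev_mul, ev_pow, ev_cst, ev_X2]
    linear_combination (ev S.T t x y - 1 + y) * S.heat t x y ht hy' +
      (1/2 * (ev S.T t x y - 1 + y) ^ 2) * S.inc t x y ht hy'
  have h1 : Tr 1 t (cst Γ (1/2) * (S.b * S.th ^ 2) - D2 S.T * S.th)
      = Tr 1 t (cst Γ 0 * S.p) := Tr_congr fun x => by
    simp only [th, D1_D2, Dt_D1, Dt_D2, Dt_add, D1_add, D2_add, Dt_sub, D1_sub, D2_sub, Dt_neg, D1_neg, D2_neg, Dt_mul, D1_mul, D2_mul,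
      Dt_sq, D1_sq, D2_sq, Dt_cst, D1_cst, D2_cst, Dt_X2, D1_X2, D2_X2, ev_add, ev_sub, ev_neg, ev_mul, ev_pow, ev_cst, ev_X2, S.btop t x ht, S.Ttop t x ht]; ring
  have h0 : Tr 0 t (cst Γ (1/2) * (S.b * S.th ^ 2) - D2 S.T * S.th)
      = Tr 0 t (cst Γ 0 * S.p) := Tr_congr fun x => by
    simp only [th, D1_D2, Dt_D1, Dt_D2, Dt_add, D1_add, D2_add, Dt_sub, D1_sub, D2_sub, Dt_neg, D1_neg, D2_neg, Dt_mul, D1_mul, D2_mul,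
      Dt_sq, D1_sq, D2_sq, Dt_cst, D1_cst, D2_cst, Dt_X2, D1_X2, D2_X2, ev_add, ev_sub, ev_neg, ev_mul, ev_pow, ev_cst, ev_X2, S.bbot t x ht, S.Tbot t x ht]; ring
  have h3 : Tr 1 t (-S.T) = Tr 1 t (cst Γ 0 * S.p) := Tr_congr fun x => by
    simp only [D1_D2, Dt_D1, Dt_D2, Dt_add, D1_add, D2_add, Dt_sub, D1_sub, D2_sub, Dt_neg, D1_neg, D2_neg, Dt_mul, D1_mul, D2_mul,
      Dt_sq, D1_sq, D2_sq, Dt_cst, D1_cst, D2_cst, Dt_X2, D1_X2, D2_X2, ev_add, ev_sub, ev_neg, ev_mul, ev_pow, ev_cst, ev_X2, S.Ttop t x ht]; ring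
  have h4 : Tr 0 t (-S.T) = -Γ := by
    have : Tr 0 t (-S.T) = Tr 0 t (cst Γ (-1)) := Tr_congr fun x => by
      simp only [D1_D2, Dt_D1, Dt_D2, Dt_add, D1_add, D2_add, Dt_sub, D1_sub, D2_sub, Dt_neg, D1_neg, D2_neg, Dt_mul, D1_mul, D2_mul,
      Dt_sq, D1_sq, D2_sq, Dt_cst, D1_cst, D2_cst, Dt_X2, D1_X2, D2_X2, ev_add, ev_sub, ev_neg, ev_mul, ev_pow, ev_cst, ev_X2, S.Tbot t x ht]
    rw [this, Tr]; simp [ev_cst]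
  simp only [I_add, I_cmul, I_D1, I_D2] at h ⊢
  rw [h1, h0, h3, h4, Tr_cmul, Tr_cmul] at h
  linarith

lemma T_avg : ∃ C D : ℝ, 0 ≤ C ∧ 0 ≤ D ∧
    ∀ t, 0 ≤ t → ∫ s in (0:ℝ)..t, I 1 s (D2 S.T ^ 2) ≤ C * t + D := by
  obtain ⟨C, D, hC, hD, h⟩ := S.G_avg
  have hΓ := S.hΓ
  refine ⟨2 * Γ + C, 1 / 2 * I 1 0 (S.th ^ 2) + D, by positivity,
    add_nonneg (mul_nonneg (by norm_num) (I_sq_nonneg 0 _ hΓ)) hD, fun t ht => ?_⟩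
  have := avg_bound (F := fun t => 1 / 2 * I 1 t (S.th ^ 2)) (C := 2 * Γ)
    (g := fun t => I 1 t (D2 S.T ^ 2) - I 1 t S.G)
    (fun t => (I_hasDerivAt 1 t _).const_mul (1/2))
    ((I_cont 1 _).sub (I_cont 1 S.G)) (fun t _ => mul_nonneg (by norm_num) (I_sq_nonneg t _ hΓ))
    (fun t ht => ?_) t ht
  · rw [intervalIntegral.integral_sub ((I_cont 1 _).intervalIntegrable _ _)
      ((I_cont 1 _).intervalIntegrable _ _)] at this
    have := h t ht
    linarith
  · have h1 := S.Temp t ht.le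
    have h2 : I 1 t (S.b * S.th) ≤ I 1 t (S.b ^ 2 + cst Γ 1) := by
      refine I_mono S.hΓ zero_le_one fun x y hy => ?_
      simp only [th, D1_D2, Dt_D1, Dt_D2, Dt_add, D1_add, D2_add, Dt_sub, D1_sub, D2_sub, Dt_neg, D1_neg, D2_neg, Dt_mul, D1_mul, D2_mul,
      Dt_sq, D1_sq, D2_sq, Dt_cst, D1_cst, D2_cst, Dt_X2, D1_X2, D2_X2, ev_add, ev_sub, ev_neg, ev_mul, ev_pow, ev_cst, ev_X2]
      obtain ⟨h0, h1⟩ := S.T01 t x y ht.le (Ioo_subset_Icc_self hy)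
      obtain ⟨hy0, hy1⟩ := hy
      have : (ev S.T t x y - 1 + y) ^ 2 ≤ 1 := by nlinarith
      nlinarith [sq_nonneg (ev S.b t x y - (ev S.T t x y - 1 + y))]
    rw [I_add, I_cst] at h2
    have := S.b_le_G t ht.le
    have := I_sq_nonneg t (D1 S.T) S.hΓ
    rw [I_add] at h1
    linarith

end Sys
end

set_option linter.unusedSimpArgs false
/-- one-dimensional Sobolev inequality -/
lemma sup1 {f f' h : ℝ → ℝ} {d : ℝ} (hd : 0 < d) (hf : ∀ x, HasDerivAt f (f' x) x)
    (hf' : Continuous f') (hh : Continuous h) (hfh : ∀ x, f x / d + |f' x| ≤ h x)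
    (x : ℝ) (hx : x ∈ Icc 0 d) : f x ≤ ∫ z in (0:ℝ)..d, h z := by
  have hfc : Continuous f := continuous_iff_continuousAt.2 fun x => (hf x).continuousAt
  obtain ⟨x0, hx0, hmin⟩ := isCompact_Icc.exists_isMinOn (nonempty_Icc.2 hd.le) hfc.continuousOn
  have h1 : ∫ z in (0:ℝ)..d, f x0 / d ≤ ∫ z in (0:ℝ)..d, f z / d := by
    apply intervalIntegral.integral_mono_on hd.le (by simp)
      ((hfc.div_const d).intervalIntegrable _ _)
    intro z hz
    have := hmin hz
    exact div_le_div_of_nonneg_right this hd.le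
  have e : ∫ z in (0:ℝ)..d, f x0 / d = f x0 := by
    rw [intervalIntegral.integral_const, smul_eq_mul]; field_simp; ring
  rw [e] at h1
  have h2 : ∫ z in x0..x, f' z = f x - f x0 :=
    intervalIntegral.integral_eq_sub_of_hasDerivAt (fun z _ => hf z) (hf'.intervalIntegrable _ _)
  have h3 : |∫ z in x0..x, f' z| ≤ ∫ z in (0:ℝ)..d, |f' z| := by
    rw [intervalIntegral.integral_of_le hd.le]
    refine (intervalIntegral.norm_integral_le_integral_norm_uIoc (f := f')).trans ?_
    apply setIntegral_mono_set
    · exact (intervalIntegrable_iff_integrableOn_Ioc_of_le hd.le).1 (hf'.abs.intervalIntegrable _ _)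
    · exact Eventually.of_forall fun z => abs_nonneg _
    · apply HasSubset.Subset.eventuallyLE
      intro z hz
      rw [mem_uIoc] at hz
      rcases hz with hz | hz
      · exact ⟨by linarith [hx0.1], by linarith [hx.2]⟩
      · exact ⟨by linarith [hx.1], by linarith [hx0.2]⟩
  have h4 : ∫ z in (0:ℝ)..d, (f z / d + |f' z|) ≤ ∫ z in (0:ℝ)..d, h z :=
    intervalIntegral.integral_mono_on hd.le
      (((hfc.div_const d).add hf'.abs).intervalIntegrable _ _) (hh.intervalIntegrable _ _)
      fun z _ => hfh z
  rw [intervalIntegral.integral_add ((hfc.div_const d).intervalIntegrable _ _)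
    (hf'.abs.intervalIntegrable _ _)] at h4
  have := le_abs_self (∫ z in x0..x, f' z)
  linarith

/-- product estimate -/
lemma prod_bound (hΓ : 0 < Γ) (t : ℝ) {f g h k : Alg Γ}
    (hg0 : ∀ x y, 0 ≤ ev g t x y) (hf0 : ∀ x y, 0 ≤ ev f t x y)
    (hf : ∀ x y, ev f t x y / Γ + |ev (D1 f) t x y| ≤ ev h t x y)
    (hg : ∀ x y, ev g t x y / 1 + |ev (D2 g) t x y| ≤ ev k t x y) :
    I 1 t (f * g) ≤ I 1 t h * I 1 t k := by
  have c1 : ∀ (u : Alg Γ) x, Continuous fun y => ev u t x y := fun u x =>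
    ev_cont' u (by fun_prop) (by fun_prop) (by fun_prop)
  have c2 : ∀ (u : Alg Γ) y, Continuous fun x => ev u t x y := fun u y =>
    ev_cont' u (by fun_prop) (by fun_prop) (by fun_prop)
  have hF : ∀ x y, x ∈ Icc 0 Γ → ev f t x y ≤ ∫ z in (0:ℝ)..Γ, ev h t z y := fun x y hx =>
    sup1 (f := fun x => ev f t x y) hΓ (fun x => hasDerivAt_1 f t x y) (c2 _ y) (c2 _ y)
      (fun x => hf x y) x hx
  have hG : ∀ x y, y ∈ Icc (0:ℝ) 1 → ev g t x y ≤ ∫ z in (0:ℝ)..1, ev k t x z := fun x y hy =>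
    sup1 (f := fun y => ev g t x y) one_pos (fun y => hasDerivAt_2 g t x y) (c1 _ x) (c1 _ x)
      (fun y => hg x y) y hy
  have cΦ : Continuous fun y => ∫ z in (0:ℝ)..Γ, ev h t z y := by
    apply intervalIntegral.continuous_parametric_intervalIntegral_of_continuous'
    exact ev_cont' h (by fun_prop) (by fun_prop) (by fun_prop)
  have cΨ : Continuous fun x => ∫ z in (0:ℝ)..1, ev k t x z := by
    apply intervalIntegral.continuous_parametric_intervalIntegral_of_continuous'
    exact ev_cont' k (by fun_prop) (by fun_prop) (by fun_prop)
  have e : I 1 t h * I 1 t k = ∫ x in (0:ℝ)..Γ, ∫ y in (0:ℝ)..1,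
      (∫ z in (0:ℝ)..Γ, ev h t z y) * (∫ z in (0:ℝ)..1, ev k t x z) := by
    rw [I_swap 1 t h]
    simp only [intervalIntegral.integral_mul_const, intervalIntegral.integral_const_mul]
    rfl
  rw [e]
  apply intervalIntegral.integral_mono_on hΓ.le (outer_ii _ _ _ _ _)
  · simp only [intervalIntegral.integral_mul_const]
    exact (continuous_const.mul cΨ).intervalIntegrable _ _
  intro x hx
  apply intervalIntegral.integral_mono_on zero_le_one (inner_ii _ _ _ _ _)
    ((cΦ.mul continuous_const).intervalIntegrable _ _)
  intro y hy
  rw [ev_mul]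
  exact mul_le_mul (hF x y hx) (hG x y hy) (hg0 x y) ((hf0 x y).trans (hF x y hx))

section
variable {κ β : ℝ} (S : Sys Γ Ra κ β)
namespace Sys

lemma gg_le (t : ℝ) (ht : 0 ≤ t) : I 1 t S.G ≤ √(I 1 t S.q) * √(I 1 t S.LL) := by
  have := opt (X := 2 * I 1 t S.G) (S.q_nonneg t) (S.LL_nonneg t) (fun s hs => ?_)
  · linarith
  have h := S.E0 t ht
  have h1 := mul_nonneg S.hβ (B_sq_nonneg S.hΓ t S.a)
  have h2 : I 1 t (-(S.a * S.La + S.b * S.Lb))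
      ≤ I 1 t (cst Γ (s/2) * S.q + cst Γ (1/s/2) * S.LL) := by
    refine I_mono S.hΓ zero_le_one fun x y hy => ?_
    simp only [q, LL, ev_neg, ev_add, ev_mul, ev_cst, ev_pow]
    have y1 := young (ev S.a t x y) (ev S.La t x y) hs
    have y2 := young (ev S.b t x y) (ev S.Lb t x y) hs
    have := neg_abs_le (ev S.a t x y * ev S.La t x y)
    have := neg_abs_le (ev S.b t x y * ev S.Lb t x y)
    have e : 1 / s / 2 * (ev S.La t x y ^ 2 + ev S.Lb t x y ^ 2)
      = (ev S.La t x y ^ 2 / s + ev S.Lb t x y ^ 2 / s) / 2 := by ring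
    rw [e]
    linarith
  rw [I_add, I_cmul, I_cmul] at h2
  have e : I 1 t S.LL / s = 2 * (1 / s / 2 * I 1 t S.LL) := by ring
  rw [e]; linarith

lemma NN_prod (t : ℝ) {s r : ℝ} (hs : 0 < s) (hr : 0 < r) :
    I 1 t (S.N1 ^ 2 + S.N2 ^ 2) ≤ (I 1 t S.q / Γ + s * I 1 t S.q + I 1 t S.G / s)
      * (I 1 t S.G + r * I 1 t S.G + I 1 t S.HH / r) := by
  have h1 : I 1 t (S.N1 ^ 2 + S.N2 ^ 2) ≤ I 1 t (S.q * S.G) := by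
    refine I_mono S.hΓ zero_le_one fun x y hy => ?_
    simp only [q, G, N1, N2, ev_add, ev_mul, ev_pow]
    nlinarith [sq_nonneg (ev S.a t x y * ev (D2 S.a) t x y - ev S.b t x y * ev (D1 S.a) t x y),
      sq_nonneg (ev S.a t x y * ev (D2 S.b) t x y - ev S.b t x y * ev (D1 S.b) t x y)]
  have h2 := prod_bound S.hΓ t (f := S.q) (g := S.G)
    (h := cst Γ (1/Γ) * S.q + cst Γ s * S.q + cst Γ (1/s) * S.G)
    (k := S.G + cst Γ r * S.G + cst Γ (1/r) * S.HH)
    (fun x y => by simp only [G, ev_add, ev_pow]; positivity)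
    (fun x y => by simp only [q, ev_add, ev_pow]; positivity)
    (fun x y => ?_) (fun x y => ?_)
  · simp only [I_add, I_cmul] at h2
    rw [I_add] at h1
    rw [I_add]
    refine h1.trans (h2.trans (le_of_eq ?_))
    ring
  · simp only [q, G, D1_add, D1_sq, ev_add, ev_mul, ev_cst, ev_pow]
    have y1 := young (ev S.a t x y) (ev (D1 S.a) t x y) hs
    have y2 := young (ev S.b t x y) (ev (D1 S.b) t x y) hs
    have a1 := abs_add_le (2 * (ev S.a t x y * ev (D1 S.a) t x y)) (2 * (ev S.b t x y * ev (D1 S.b) t x y))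
    rw [abs_mul, abs_mul 2, abs_two] at a1
    have p1 : 0 ≤ 1/s * ev (D2 S.a) t x y ^ 2 := by positivity
    have p2 : 0 ≤ 1/s * ev (D2 S.b) t x y ^ 2 := by positivity
    simp only [div_eq_mul_inv, one_mul] at *
    nlinarith
  · simp only [HH, G, D2_add, D2_sq, D1_D2, ev_add, ev_mul, ev_cst, ev_pow]
    have y1 := young (ev (D1 S.a) t x y) (ev (D2 (D1 S.a)) t x y) hr
    have y2 := young (ev (D2 S.a) t x y) (ev (D2 (D2 S.a)) t x y) hr
    have y3 := young (ev (D1 S.b) t x y) (ev (D2 (D1 S.b)) t x y) hr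
    have y4 := young (ev (D2 S.b) t x y) (ev (D2 (D2 S.b)) t x y) hr
    have a1 := abs_add_le (2 * (ev (D1 S.a) t x y * ev (D2 (D1 S.a)) t x y)
      + 2 * (ev (D2 S.a) t x y * ev (D2 (D2 S.a)) t x y)
      + 2 * (ev (D1 S.b) t x y * ev (D2 (D1 S.b)) t x y)) (2 * (ev (D2 S.b) t x y * ev (D2 (D2 S.b)) t x y))
    have a2 := abs_add_le (2 * (ev (D1 S.a) t x y * ev (D2 (D1 S.a)) t x y)
      + 2 * (ev (D2 S.a) t x y * ev (D2 (D2 S.a)) t x y))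
      (2 * (ev (D1 S.b) t x y * ev (D2 (D1 S.b)) t x y))
    have a3 := abs_add_le (2 * (ev (D1 S.a) t x y * ev (D2 (D1 S.a)) t x y))
      (2 * (ev (D2 S.a) t x y * ev (D2 (D2 S.a)) t x y))
    have t2 : ∀ z : ℝ, |2 * z| = 2 * |z| := fun z => by rw [abs_mul, abs_two]
    rw [t2] at a1 a2
    rw [t2, t2] at a3
    have p1 : 0 ≤ 1/r * ev (D1 (D1 S.a)) t x y ^ 2 := by positivity
    have p2 : 0 ≤ 1/r * ev (D1 (D1 S.b)) t x y ^ 2 := by positivity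
    have p3 : 0 ≤ 1/r * ev (D2 (D1 S.a)) t x y ^ 2 := by positivity
    have p4 : 0 ≤ 1/r * ev (D2 (D1 S.b)) t x y ^ 2 := by positivity
    simp only [div_eq_mul_inv, one_mul, inv_one, mul_one] at *
    nlinarith

lemma NN_bound {M : ℝ} (hM : 0 ≤ M) (t : ℝ) (ht : 0 ≤ t) (hq : I 1 t S.q ≤ M) :
    I 1 t (S.N1 ^ 2 + S.N2 ^ 2) ≤ M * (2 / Γ + 5) * (I 1 t S.LL + I 1 t S.G) := by
  have hΓ := S.hΓ
  have hg := S.G_nonneg t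
  have hL := S.LL_nonneg t
  have hgg := S.gg_le t ht
  have hHL := S.HL t ht
  have hH := S.HH_nonneg t
  have hX : ∀ s r : ℝ, 0 < s → 0 < r → I 1 t (S.N1 ^ 2 + S.N2 ^ 2) ≤
      (M / Γ + s * M + I 1 t S.G / s) * (I 1 t S.G + r * I 1 t S.G + I 1 t S.LL / r) := by
    intro s r hs hr
    refine (S.NN_prod t hs hr).trans ?_
    have := S.q_nonneg t
    gcongr
  generalize I 1 t (S.N1 ^ 2 + S.N2 ^ 2) = X at *
  have hgm : I 1 t S.G ≤ √M * √(I 1 t S.LL) :=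
    hgg.trans (mul_le_mul_of_nonneg_right (Real.sqrt_le_sqrt hq) (Real.sqrt_nonneg _))
  generalize I 1 t S.G = g at *
  generalize I 1 t S.LL = L at *
  have em := Real.sq_sqrt hM
  have eg := Real.sq_sqrt hg
  have eL := Real.sq_sqrt hL
  have h1 : ∀ r : ℝ, 0 < r → X ≤ (M / Γ + 2 * (√M * √g)) * (g + r * g + L / r) := by
    intro r hr
    set k := g + r * g + L / r
    have hk : 0 ≤ k := by positivity
    have := opt (X := X - M / Γ * k) (B := M * k) (C := g * k) (by positivity) (by positivity)
      (fun s hs => by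
        have := hX s r hs hr
        have e : (M / Γ + s * M + g / s) * k = M / Γ * k + (s * (M * k) + g * k / s) := by ring
        rw [e] at this; linarith)
    rw [Real.sqrt_mul hM, Real.sqrt_mul hg] at this
    have ek := Real.mul_self_sqrt hk
    have e2 : √M * √k * (√g * √k) = √M * √g * (√k * √k) := by ring
    rw [e2, ek] at this
    linarith
  set A := M / Γ + 2 * (√M * √g) with hA
  have hA0 : 0 ≤ A := by positivity
  have h2 := opt (X := X - A * g) (B := g * A) (C := L * A) (by positivity) (by positivity)
      (fun r hr => by
        have := h1 r hr
        have e : A * (g + r * g + L / r) = A * g + (r * (g * A) + L * A / r) := by ring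
        rw [e] at this; linarith)
  rw [Real.sqrt_mul hg, Real.sqrt_mul hL] at h2
  have ek := Real.mul_self_sqrt hA0
  have e2 : √g * √A * (√L * √A) = √g * √L * (√A * √A) := by ring
  rw [e2, ek] at h2
  have m0 := Real.sqrt_nonneg M
  have g0 := Real.sqrt_nonneg g
  have L0 := Real.sqrt_nonneg L
  generalize √M = m at *
  generalize √g = c at *
  generalize √L = d at *
  subst em eg eL
  have h3 : X ≤ (m ^ 2 / Γ + 2 * (m * c)) * (c ^ 2 + 2 * (c * d)) := by rw [← hA]; linarith
  refine h3.trans ?_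
  have i1 : m * c * c ^ 2 ≤ m * c * (m * d) := mul_le_mul_of_nonneg_left hgm (by positivity)
  have i2 : c ^ 2 * (m * d) ≤ m * d * (m * d) := mul_le_mul_of_nonneg_right hgm (by positivity)
  have i3 : 2 * (c * d) ≤ c ^ 2 + d ^ 2 := by nlinarith [sq_nonneg (c - d)]
  have i4 : m ^ 2 * (2 * (c * d)) ≤ m ^ 2 * (c ^ 2 + d ^ 2) := mul_le_mul_of_nonneg_left i3 (by positivity)
  have i5 : m ^ 2 / Γ * (2 * (c * d)) ≤ m ^ 2 / Γ * (c ^ 2 + d ^ 2) :=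
    mul_le_mul_of_nonneg_left i3 (by positivity)
  have i6 : 0 ≤ m ^ 2 / Γ * d ^ 2 := by positivity
  have i7 : 0 ≤ m ^ 2 * c ^ 2 := by positivity
  have e3 : m ^ 2 * (2 / Γ + 5) * (d ^ 2 + c ^ 2)
    = 2 * (m ^ 2 / Γ * d ^ 2) + 2 * (m ^ 2 / Γ * c ^ 2) + 5 * (m ^ 2 * (d ^ 2 + c ^ 2)) := by ring
  have e4 : (m ^ 2 / Γ + 2 * (m * c)) * (c ^ 2 + 2 * (c * d)) = m ^ 2 / Γ * c ^ 2
    + m ^ 2 / Γ * (2 * (c * d)) + 2 * (m * c * c ^ 2) + 4 * (c ^ 2 * (m * d)) := by ring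
  rw [e3, e4]
  nlinarith

end Sys
end

set_option linter.unusedSimpArgs false
lemma yq (x y : ℝ) {c : ℝ} (hc : 0 < c) : x * y ≤ c * x ^ 2 + y ^ 2 / (4 * c) := by
  have h : 0 ≤ (2 * c * x - y) ^ 2 / (4 * c) := by positivity
  have e : (2 * c * x - y) ^ 2 / (4 * c) = c * x ^ 2 + y ^ 2 / (4 * c) - x * y := by
    field_simp; ring
  linarith

lemma pw {κ β l Ra La Lb at' bt n1 n2 T w1 w2 p1 p2 : ℝ} (hκ : 0 < κ) (hl : 0 < l)
    (hT : T ^ 2 ≤ 1) (h1 : p1 = La - κ * (at' + n1)) (h2 : p2 = Ra * T + Lb - κ * (bt + n2)) :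
    -Ra * (T * Lb) - β * (w1 * p1 + w2 * p2) - l * κ * (n1 * at' + n2 * bt) + l * Ra * (T * bt)
    ≤ 1 / 4 * (La ^ 2 + Lb ^ 2) + 3 / 4 * (l * κ) * (at' ^ 2 + bt ^ 2)
      + 2 * (l * κ) * (n1 ^ 2 + n2 ^ 2)
      + (3 * β ^ 2 + 5 / 4 * (β ^ 2 * κ / l)) * (w1 ^ 2 + w2 ^ 2) + (3 * Ra ^ 2 + l * Ra ^ 2 / κ) := by
  subst h1 h2
  have hlκ : 0 < l * κ := by positivity
  have hRT : Ra ^ 2 * T ^ 2 ≤ Ra ^ 2 * 1 := mul_le_mul_of_nonneg_left hT (sq_nonneg _)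
  have a1 : -Ra * (T * Lb) ≤ 1 / 8 * Lb ^ 2 + 2 * (Ra ^ 2 * T ^ 2) := by
    nlinarith [sq_nonneg (Lb + 4 * (Ra * T))]
  have a2 : -β * (w1 * La) ≤ 1 / 8 * La ^ 2 + 2 * (β ^ 2 * w1 ^ 2) := by
    nlinarith [sq_nonneg (La + 4 * (β * w1))]
  have a3 : -β * (w2 * Lb) ≤ 1 / 8 * Lb ^ 2 + 2 * (β ^ 2 * w2 ^ 2) := by
    nlinarith [sq_nonneg (Lb + 4 * (β * w2))]
  have a4 : -β * (w2 * (Ra * T)) ≤ β ^ 2 * w2 ^ 2 + Ra ^ 2 * T ^ 2 := by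
    nlinarith [sq_nonneg (β * w2 + Ra * T), sq_nonneg (β * w2), sq_nonneg (Ra * T)]
  have yu : ∀ u w : ℝ, β * κ * (w * u) ≤ l * κ / 4 * u ^ 2 + β ^ 2 * κ / l * w ^ 2 := by
    intro u w
    have := yq u (β * κ * w) (c := l * κ / 4) (by positivity)
    have e : (β * κ * w) ^ 2 / (4 * (l * κ / 4)) = β ^ 2 * κ / l * w ^ 2 := by field_simp
    rw [e] at this; linarith
  have yn : ∀ u w : ℝ, β * κ * (w * u) ≤ l * κ * u ^ 2 + 1 / 4 * (β ^ 2 * κ / l) * w ^ 2 := by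
    intro u w
    have := yq u (β * κ * w) (c := l * κ) (by positivity)
    have e : (β * κ * w) ^ 2 / (4 * (l * κ)) = 1 / 4 * (β ^ 2 * κ / l) * w ^ 2 := by field_simp
    rw [e] at this; linarith
  have nu : ∀ n u : ℝ, -(l * κ * (n * u)) ≤ l * κ * n ^ 2 + l * κ / 4 * u ^ 2 := by
    intro n u
    nlinarith [mul_nonneg hlκ.le (sq_nonneg (2 * n + u))]
  have a5 : l * Ra * (T * bt) ≤ l * κ / 4 * bt ^ 2 + l * Ra ^ 2 / κ := by
    have := yq bt (l * Ra * T) (c := l * κ / 4) (by positivity)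
    have e : (l * Ra * T) ^ 2 / (4 * (l * κ / 4)) = l / κ * (Ra ^ 2 * T ^ 2) := by field_simp
    rw [e] at this
    have h3 : l / κ * (Ra ^ 2 * T ^ 2) ≤ l / κ * (Ra ^ 2 * 1) :=
      mul_le_mul_of_nonneg_left hRT (by positivity)
    have e2 : l * Ra ^ 2 / κ = l / κ * (Ra ^ 2 * 1) := by ring
    rw [e2]; linarith
  have b1 := yu at' w1
  have b2 := yu bt w2
  have b3 := yn n1 w1
  have b4 := yn n2 w2
  have b5 := nu n1 at'
  have b6 := nu n2 bt
  have p0 : 0 ≤ l * κ * at' ^ 2 := by positivity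
  have p1 : 0 ≤ La ^ 2 := by positivity
  have p2 : 0 ≤ β ^ 2 * w1 ^ 2 := by positivity
  have p3 : 0 ≤ Lb ^ 2 := by positivity
  generalize β ^ 2 * κ / l = z at *
  generalize l * Ra ^ 2 / κ = z' at *
  linarith

section
variable {κ β : ℝ} (S : Sys Γ Ra κ β)
namespace Sys

lemma w_bound (t : ℝ) : I 1 t (S.w1 ^ 2 + S.w2 ^ 2) ≤ 8 * I 1 t S.q + 2 * I 1 t S.G := by
  have : I 1 t (S.w1 ^ 2 + S.w2 ^ 2) ≤ I 1 t (cst Γ 8 * S.q + cst Γ 2 * S.G) := by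
    refine I_mono S.hΓ zero_le_one fun x y hy => ?_
    simp only [w1, w2, phi, q, G, ev_add, ev_mul, ev_pow, ev_cst, ev_neg, ev_sub, ev_X2]
    have hp : (2 * y - 1) ^ 2 ≤ 1 := by nlinarith [hy.1, hy.2]
    generalize 2 * y - 1 = z at *
    have i1 := mul_nonneg (sub_nonneg.2 hp) (sq_nonneg (ev (D2 S.a) t x y))
    have i2 := mul_nonneg (sub_nonneg.2 hp) (sq_nonneg (ev (D1 S.a) t x y))
    nlinarith [sq_nonneg (2 * ev S.a t x y - z * ev (D2 S.a) t x y), sq_nonneg (ev S.b t x y),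
      sq_nonneg (ev (D1 S.b) t x y), sq_nonneg (ev (D2 S.b) t x y), sq_nonneg (ev (D1 S.a) t x y)]
  rw [I_add (f := cst Γ 8 * S.q), I_cmul, I_cmul] at this
  exact this

lemma H1ineq : ∃ μ C : ℝ, 0 ≤ μ ∧ 0 ≤ C ∧ ∀ t, 0 < t →
    μ * S.Yt t + 1 / 2 * I 1 t S.LL ≤ C + C * I 1 t S.G := by
  have hΓ := S.hΓ
  have hκ := S.hκ
  have hTsq : ∀ t x y, 0 < t → y ∈ Ioo (0:ℝ) 1 → ev S.T t x y ^ 2 ≤ 1 := by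
    intro t x y ht hy
    obtain ⟨h0, h1⟩ := S.T01 t x y ht.le (Ioo_subset_Icc_self hy)
    nlinarith
  rcases S.hβ.eq_or_lt with hb | hb
  · refine ⟨κ / 2, 1 / 2 * Ra ^ 2 * Γ, by positivity, by positivity, fun t ht => ?_⟩
    have h := S.E2 t ht
    have hz : β * I 1 t (S.w1 * D1 S.p + S.w2 * D2 S.p) = 0 := mul_eq_zero_of_left hb.symm _
    rw [hz, add_zero] at h
    have h1 : I 1 t (cst Γ (-Ra) * (S.T * S.Lb)) ≤ I 1 t (cst Γ (1/2) * S.LL + cst Γ (1 / 2 * Ra ^ 2)) := by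
      refine I_mono S.hΓ zero_le_one fun x y hy => ?_
      simp only [LL, ev_add, ev_mul, ev_pow, ev_cst]
      have hRT : Ra ^ 2 * ev S.T t x y ^ 2 ≤ Ra ^ 2 * 1 :=
        mul_le_mul_of_nonneg_left (hTsq t x y ht hy) (sq_nonneg _)
      nlinarith [sq_nonneg (ev S.Lb t x y + Ra * ev S.T t x y), sq_nonneg (ev S.La t x y)]
    rw [I_cmul, I_add, I_cmul, I_cst] at h1
    have h0 : 0 ≤ 1 / 2 * Ra ^ 2 * Γ * I 1 t S.G := mul_nonneg (by positivity) (S.G_nonneg t)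
    linarith
  · obtain ⟨M, hM, hq⟩ := S.q_bdd hb
    set K := M * (2 / Γ + 5) with hK
    have hK0 : 0 ≤ K := by positivity
    set l := 1 / (8 * κ * (K + 1)) with hl
    have hl0 : 0 < l := by positivity
    have hlK : 2 * (l * κ) * K ≤ 1 / 4 := by
      rw [hl]
      have : 2 * (1 / (8 * κ * (K + 1)) * κ) * K = K / (K + 1) / 4 := by field_simp; ring
      rw [this]
      have : K / (K + 1) ≤ 1 := by rw [div_le_one (by positivity)]; linarith
      linarith
    set W := 3 * β ^ 2 + 5 / 4 * (β ^ 2 * κ / l) with hW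
    have hW0 : 0 ≤ W := by positivity
    set C0 := 3 * Ra ^ 2 + l * Ra ^ 2 / κ with hC0
    have hC00 : 0 ≤ C0 := by positivity
    refine ⟨κ / 2 + l / 2, 1 / 4 + W * (8 * M + 2) + Γ * C0, by positivity, by positivity,
      fun t ht => ?_⟩
    have h2 := S.E2 t ht
    have h3 := S.E3 t ht
    have hpt : I 1 t (cst Γ (-Ra) * (S.T * S.Lb) + cst Γ (-β) * (S.w1 * D1 S.p + S.w2 * D2 S.p)
        + cst Γ (-(l * κ)) * (S.N1 * Dt S.a + S.N2 * Dt S.b) + cst Γ (l * Ra) * (S.T * Dt S.b))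
        ≤ I 1 t (cst Γ (1/4) * S.LL + cst Γ (3 / 4 * (l * κ)) * (Dt S.a ^ 2 + Dt S.b ^ 2)
        + cst Γ (2 * (l * κ)) * (S.N1 ^ 2 + S.N2 ^ 2) + cst Γ W * (S.w1 ^ 2 + S.w2 ^ 2)
        + cst Γ C0) := by
      refine I_mono S.hΓ zero_le_one fun x y hy => ?_
      have hy' := Ioo_subset_Icc_self hy
      have m1 := S.m1 t x y ht.le hy'
      have m2 := S.m2 t x y ht.le hy'
      have := pw (κ := κ) (β := β) (l := l) (Ra := Ra) (La := ev S.La t x y) (Lb := ev S.Lb t x y)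
        (at' := ev (Dt S.a) t x y) (bt := ev (Dt S.b) t x y) (n1 := ev S.N1 t x y)
        (n2 := ev S.N2 t x y) (T := ev S.T t x y) (w1 := ev S.w1 t x y) (w2 := ev S.w2 t x y)
        (p1 := ev (D1 S.p) t x y) (p2 := ev (D2 S.p) t x y) hκ hl0 (hTsq t x y ht hy)
        (by simp only [La, N1, ev_add, ev_mul]; linarith)
        (by simp only [Lb, N2, ev_add, ev_mul]; linarith)
      rw [← hW, ← hC0] at this
      simp only [LL, ev_add, ev_mul, ev_pow, ev_cst]
      linarith
    rw [I_add, I_add, I_add, I_cmul, I_cmul, I_cmul, I_cmul, I_add _ _ _ (cst Γ C0),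
      I_add _ _ _ (cst Γ W * _), I_add _ _ _ (cst Γ (2 * (l * κ)) * _),
      I_add _ _ (cst Γ (1/4) * _), I_cmul, I_cmul, I_cmul, I_cmul, I_cst] at hpt
    have hN := S.NN_bound hM t ht.le (hq t ht.le)
    rw [← hK] at hN
    have hw := S.w_bound t
    have hL := S.LL_nonneg t
    have hg := S.G_nonneg t
    have hut : 0 ≤ I 1 t (Dt S.a ^ 2 + Dt S.b ^ 2) := by
      rw [I_add]; exact add_nonneg (I_sq_nonneg t _ hΓ) (I_sq_nonneg t _ hΓ)
    have hqM := hq t ht.le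
    have hE3 := congrArg (fun z => l * z) h3
    generalize I 1 t (Dt S.a ^ 2 + Dt S.b ^ 2) = ut at *
    generalize I 1 t (S.N1 * Dt S.a + S.N2 * Dt S.b) = nu at *
    generalize I 1 t (S.w1 * D1 S.p + S.w2 * D2 S.p) = wp at *
    generalize I 1 t (S.N1 ^ 2 + S.N2 ^ 2) = nn at *
    generalize I 1 t (S.w1 ^ 2 + S.w2 ^ 2) = ww at *
    generalize I 1 t S.LL = L at *
    generalize I 1 t S.G = g at *
    have k1 : 2 * (l * κ) * nn ≤ 2 * (l * κ) * (K * (L + g)) := mul_le_mul_of_nonneg_left hN (by positivity)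
    have k2 : 2 * (l * κ) * K * (L + g) ≤ 1 / 4 * (L + g) := mul_le_mul_of_nonneg_right hlK (by positivity)
    have k3 : W * ww ≤ W * (8 * M + 2 * g) := mul_le_mul_of_nonneg_left (by linarith) hW0
    have k4 : 0 ≤ l * κ * ut := by positivity
    have k5 : 0 ≤ W * (8 * M) * g := by positivity
    have k6 : 0 ≤ Γ * C0 * g := by positivity
    nlinarith

lemma HH_avg : ∃ C D : ℝ, 0 ≤ C ∧ 0 ≤ D ∧
    ∀ t, 0 ≤ t → ∫ s in (0:ℝ)..t, I 1 s S.HH ≤ C * t + D := by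
  obtain ⟨C, D, hC, hD, h⟩ := S.G_avg
  obtain ⟨μ, A, hμ, hA, h1⟩ := S.H1ineq
  have hΓ := S.hΓ
  have hY0 : ∀ t, 0 ≤ μ * (I 1 t S.G + β * B t (S.a ^ 2)) := fun t =>
    mul_nonneg hμ (add_nonneg (S.G_nonneg t) (mul_nonneg S.hβ (B_sq_nonneg hΓ t _)))
  refine ⟨2 * A + 2 * A * C, 2 * (μ * (I 1 0 S.G + β * B 0 (S.a ^ 2))) + 2 * A * D, by positivity,
    add_nonneg (mul_nonneg zero_le_two (hY0 0)) (by positivity), fun t ht => ?_⟩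
  have c1 : Continuous fun t => 1 / 2 * I 1 t S.LL := continuous_const.mul (I_cont 1 _)
  have c2 : Continuous fun t => A * I 1 t S.G := continuous_const.mul (I_cont 1 _)
  have := avg_bound (F := fun t => μ * (I 1 t S.G + β * B t (S.a ^ 2))) (C := A)
    (g := fun t => 1 / 2 * I 1 t S.LL - A * I 1 t S.G)
    (fun t => ((I_hasDerivAt 1 t _).add ((B_hasDerivAt t _).const_mul β)).const_mul μ)
    (c1.sub c2) (fun t _ => hY0 t)
    (fun t ht => ?_) t ht
  · rw [intervalIntegral.integral_sub (c1.intervalIntegrable _ _)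
      (c2.intervalIntegrable _ _),
      intervalIntegral.integral_const_mul, intervalIntegral.integral_const_mul] at this
    have h2 := mul_le_mul_of_nonneg_left (h t ht) hA
    have h3 : ∫ s in (0:ℝ)..t, I 1 s S.HH ≤ ∫ s in (0:ℝ)..t, I 1 s S.LL :=
      intervalIntegral.integral_mono_on ht ((I_cont 1 _).intervalIntegrable _ _)
        ((I_cont 1 _).intervalIntegrable _ _) fun s hs => S.HL s hs.1
    linarith
  · have := h1 t ht
    rw [Yt] at this
    linarith

end Sys
end

set_option linter.unusedSimpArgs false
lemma abs_int {f : ℝ → ℝ} {d : ℝ} (hd : 0 < d) (hf : Continuous f) {x x0 : ℝ}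
    (hx : x ∈ Icc 0 d) (hx0 : x0 ∈ Icc 0 d) : |∫ z in x0..x, f z| ≤ ∫ z in (0:ℝ)..d, |f z| := by
  rw [intervalIntegral.integral_of_le hd.le]
  refine (intervalIntegral.norm_integral_le_integral_norm_uIoc (f := f)).trans ?_
  apply setIntegral_mono_set
  · exact (intervalIntegrable_iff_integrableOn_Ioc_of_le hd.le).1 (hf.abs.intervalIntegrable _ _)
  · exact Eventually.of_forall fun z => abs_nonneg _
  · apply HasSubset.Subset.eventuallyLE
    intro z hz
    rw [mem_uIoc] at hz
    rcases hz with hz | hz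
    · exact ⟨by linarith [hx0.1], by linarith [hx.2]⟩
    · exact ⟨by linarith [hx.1], by linarith [hx0.2]⟩

/-- Cauchy-Schwarz against 1 -/
lemma cs1 {f : ℝ → ℝ} {y : ℝ} (hy : 0 < y) (hf : Continuous f) :
    (∫ z in (0:ℝ)..y, f z) ^ 2 ≤ y * ∫ z in (0:ℝ)..y, f z ^ 2 := by
  set m := (∫ z in (0:ℝ)..y, f z) / y with hm
  have e : (∫ z in (0:ℝ)..y, f z) = m * y := by rw [hm]; field_simp
  have h : ∫ z in (0:ℝ)..y, (2 * m * f z - m ^ 2) ≤ ∫ z in (0:ℝ)..y, f z ^ 2 := by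
    apply intervalIntegral.integral_mono_on hy.le
      (Continuous.intervalIntegrable (by fun_prop) _ _)
      (Continuous.intervalIntegrable (by fun_prop) _ _)
    intro z _
    nlinarith [sq_nonneg (f z - m)]
  rw [intervalIntegral.integral_sub (Continuous.intervalIntegrable (by fun_prop) _ _) (by simp),
    intervalIntegral.integral_const_mul, e, intervalIntegral.integral_const, smul_eq_mul] at h
  rw [e]
  nlinarith

section
variable {κ β : ℝ} (S : Sys Γ Ra κ β)
namespace Sys

lemma I_b (t : ℝ) (ht : 0 ≤ t) {δ : ℝ} (hδ : δ ∈ Ioo (0:ℝ) 1) : I δ t S.b = 0 := by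
  have h : I δ t S.b = I δ t (D2 ((X2 Γ - cst Γ δ) * S.b) + D1 ((X2 Γ - cst Γ δ) * S.a)) := by
    refine I_congr S.hΓ hδ.1.le fun x y hy => ?_
    simp only [D1_D2, Dt_D1, Dt_D2, Dt_add, D1_add, D2_add, Dt_sub, D1_sub, D2_sub, Dt_neg, D1_neg, D2_neg, Dt_mul, D1_mul, D2_mul,
      Dt_sq, D1_sq, D2_sq, Dt_cst, D1_cst, D2_cst, Dt_X2, D1_X2, D2_X2, ev_add, ev_sub, ev_neg, ev_mul, ev_pow, ev_cst, ev_X2]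
    linear_combination (δ - y) * S.inc t x y ht ⟨hy.1.le, (hy.2.trans hδ.2).le⟩
  have h1 : Tr δ t ((X2 Γ - cst Γ δ) * S.b) = Tr δ t (cst Γ 0 * S.b) := Tr_congr fun x => by
    simp only [D1_D2, Dt_D1, Dt_D2, Dt_add, D1_add, D2_add, Dt_sub, D1_sub, D2_sub, Dt_neg, D1_neg, D2_neg, Dt_mul, D1_mul, D2_mul,
      Dt_sq, D1_sq, D2_sq, Dt_cst, D1_cst, D2_cst, Dt_X2, D1_X2, D2_X2, ev_add, ev_sub, ev_neg, ev_mul, ev_pow, ev_cst, ev_X2]; ring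
  have h0 : Tr 0 t ((X2 Γ - cst Γ δ) * S.b) = Tr 0 t (cst Γ 0 * S.b) := Tr_congr fun x => by
    simp only [D1_D2, Dt_D1, Dt_D2, Dt_add, D1_add, D2_add, Dt_sub, D1_sub, D2_sub, Dt_neg, D1_neg, D2_neg, Dt_mul, D1_mul, D2_mul,
      Dt_sq, D1_sq, D2_sq, Dt_cst, D1_cst, D2_cst, Dt_X2, D1_X2, D2_X2, ev_add, ev_sub, ev_neg, ev_mul, ev_pow, ev_cst, ev_X2, S.bbot t x ht]; ring
  rw [h, I_add, I_D1, I_D2, h1, h0, Tr_cmul, Tr_cmul]; ring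

/-- pointwise-in-time version of the interpolation bound -/
lemma main_t (t : ℝ) (ht : 0 ≤ t) {δ s : ℝ} (hδ : δ ∈ Ioo (0:ℝ) 1) (hs : 0 < s) :
    I δ t (S.b * S.T) ≤ δ * (1 / 2 * I 1 t (D2 S.T ^ 2)
      + 1 / 2 * δ ^ 3 * (s * I 1 t S.G + I 1 t S.HH / s)) := by
  set R : Alg Γ := cst Γ s * S.G + cst Γ (1/s) * S.HH with hR
  have eR : s * I 1 t S.G + I 1 t S.HH / s = I 1 t R := by
    rw [hR, I_add, I_cmul, I_cmul]; ring
  have c1 : ∀ (u : Alg Γ) x, Continuous fun y => ev u t x y := fun u x =>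
    ev_cont' u (by fun_prop) (by fun_prop) (by fun_prop)
  have eI : I δ t (S.b * S.T) = I δ t (S.b * (S.T - cst Γ 1)) := by
    have : S.b * (S.T - cst Γ 1) = S.b * S.T - cst Γ 1 * S.b := by ring
    rw [this, I_sub, I_cmul, S.I_b t ht hδ]; ring
  rw [eR, eI]
  have key : ∀ x y, y ∈ Icc 0 δ → ev S.b t x y * (ev S.T t x y - 1) ≤
      1 / 2 * (∫ z in (0:ℝ)..1, ev (D2 S.T ^ 2) t x z) + 1 / 2 * δ ^ 3 * ∫ z in (0:ℝ)..1, ev R t x z := by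
    intro x y hy
    have hA : 0 ≤ ∫ z in (0:ℝ)..1, ev (D2 S.T ^ 2) t x z :=
      intervalIntegral.integral_nonneg zero_le_one fun z _ => by rw [ev_pow]; positivity
    have hB : 0 ≤ ∫ z in (0:ℝ)..1, ev R t x z :=
      intervalIntegral.integral_nonneg zero_le_one fun z _ => by
        simp only [hR, G, HH, ev_add, ev_mul, ev_pow, ev_cst]; positivity
    rcases hy.1.eq_or_lt with h0 | h0
    · rw [← h0, S.bbot t x ht, zero_mul]
      have := hδ.1
      positivity
    have hy1 : y < 1 := hy.2.trans_lt hδ.2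
    have hT : (ev S.T t x y - 1) ^ 2 ≤ y * ∫ z in (0:ℝ)..1, ev (D2 S.T ^ 2) t x z := by
      have h1 : ∫ z in (0:ℝ)..y, ev (D2 S.T) t x z = ev S.T t x y - ev S.T t x 0 :=
        intervalIntegral.integral_eq_sub_of_hasDerivAt (fun z _ => hasDerivAt_2 S.T t x z)
          (inner_ii _ _ _ _ _)
      rw [S.Tbot t x ht] at h1
      rw [← h1]
      refine (cs1 h0 (c1 _ x)).trans (mul_le_mul_of_nonneg_left ?_ h0.le)
      exact intervalIntegral.integral_mono_interval le_rfl h0.le hy1.le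
        (Eventually.of_forall fun z => sq_nonneg _) (((c1 (D2 S.T) x).pow 2).intervalIntegrable _ _)
    have hb2 : ∀ y ∈ Icc (0:ℝ) 1, ev (D2 S.b) t x y ^ 2 ≤ ∫ z in (0:ℝ)..1, ev R t x z := by
      intro y hy
      obtain ⟨z, hz, hz0⟩ := exists_hasDerivAt_eq_zero (f := fun y => ev S.b t x y)
        (f' := fun y => ev (D2 S.b) t x y) one_pos (c1 _ x).continuousOn
        (by rw [S.bbot t x ht, S.btop t x ht]) (fun y _ => hasDerivAt_2 S.b t x y)
      have h1 : ∫ w in z..y, ev (D2 (D2 S.b ^ 2)) t x w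
          = ev (D2 S.b ^ 2) t x y - ev (D2 S.b ^ 2) t x z :=
        intervalIntegral.integral_eq_sub_of_hasDerivAt (fun w _ => hasDerivAt_2 (D2 S.b ^ 2) t x w)
          (inner_ii _ _ _ _ _)
      rw [ev_pow, ev_pow, hz0] at h1
      have h2 := abs_int one_pos (c1 (D2 (D2 S.b ^ 2)) x) hy (Ioo_subset_Icc_self hz)
      have h3 : ∫ w in (0:ℝ)..1, |ev (D2 (D2 S.b ^ 2)) t x w| ≤ ∫ w in (0:ℝ)..1, ev R t x w := by
        apply intervalIntegral.integral_mono_on zero_le_one ((c1 _ x).abs.intervalIntegrable _ _)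
          (inner_ii _ _ _ _ _)
        intro w _
        have y1 := young (ev (D2 S.b) t x w) (ev (D2 (D2 S.b)) t x w) hs
        simp only [hR, G, HH, D2_sq, ev_add, ev_mul, ev_pow, ev_cst]
        rw [abs_mul, abs_two]
        refine y1.trans ?_
        have p1 : 0 ≤ s * (ev (D1 S.a) t x w ^ 2 + ev (D2 S.a) t x w ^ 2 + ev (D1 S.b) t x w ^ 2) := by
          positivity
        have p2 : 0 ≤ 1 / s * (ev (D1 (D1 S.a)) t x w ^ 2 + 2 * ev (D2 (D1 S.a)) t x w ^ 2
          + ev (D2 (D2 S.a)) t x w ^ 2 + ev (D1 (D1 S.b)) t x w ^ 2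
          + 2 * ev (D2 (D1 S.b)) t x w ^ 2) := by positivity
        have e : ev (D2 (D2 S.b)) t x w ^ 2 / s = 1 / s * ev (D2 (D2 S.b)) t x w ^ 2 := by ring
        rw [e]
        nlinarith
      have := le_abs_self (∫ w in z..y, ev (D2 (D2 S.b ^ 2)) t x w)
      nlinarith
    have hb : ev S.b t x y ^ 2 ≤ y ^ 2 * ∫ z in (0:ℝ)..1, ev R t x z := by
      have h1 : ∫ z in (0:ℝ)..y, ev (D2 S.b) t x z = ev S.b t x y - ev S.b t x 0 :=
        intervalIntegral.integral_eq_sub_of_hasDerivAt (fun z _ => hasDerivAt_2 S.b t x z)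
          (inner_ii _ _ _ _ _)
      rw [S.bbot t x ht, sub_zero] at h1
      have h2 := cs1 h0 (c1 (D2 S.b) x)
      rw [h1] at h2
      have h3 : ∫ z in (0:ℝ)..y, ev (D2 S.b) t x z ^ 2 ≤ ∫ z in (0:ℝ)..y, (∫ z in (0:ℝ)..1, ev R t x z) :=
        intervalIntegral.integral_mono_on h0.le (((c1 (D2 S.b) x).pow 2).intervalIntegrable _ _) (by simp)
          fun z hz => hb2 z ⟨hz.1, hz.2.trans hy1.le⟩
      rw [intervalIntegral.integral_const, smul_eq_mul, sub_zero] at h3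
      have := mul_le_mul_of_nonneg_left h3 h0.le
      nlinarith
    generalize (∫ z in (0:ℝ)..1, ev (D2 S.T ^ 2) t x z) = A at *
    generalize (∫ z in (0:ℝ)..1, ev R t x z) = E at *
    have hsq : (ev S.b t x y * (ev S.T t x y - 1)) ^ 2 ≤ (1 / 2 * A + 1 / 2 * y ^ 3 * E) ^ 2 := by
      have := mul_le_mul hb hT (sq_nonneg _) (by positivity)
      rw [mul_pow]
      nlinarith [sq_nonneg (A - y ^ 3 * E)]
    have h5 := abs_le_of_sq_le_sq hsq (by positivity)
    refine (le_abs_self _).trans (h5.trans ?_)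
    have : y ^ 3 ≤ δ ^ 3 := pow_le_pow_left₀ h0.le hy.2 3
    have := mul_le_mul_of_nonneg_right this hB
    linarith
  have cA : Continuous fun x => ∫ z in (0:ℝ)..1, ev (D2 S.T ^ 2) t x z :=
    (inner_cont (D2 S.T ^ 2) 1).comp (f := fun x : ℝ => (t, x)) (by fun_prop)
  have cR : Continuous fun x => ∫ z in (0:ℝ)..1, ev R t x z :=
    (inner_cont R 1).comp (f := fun x : ℝ => (t, x)) (by fun_prop)
  have cK : Continuous fun x => δ * (1 / 2 * (∫ z in (0:ℝ)..1, ev (D2 S.T ^ 2) t x z)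
      + 1 / 2 * δ ^ 3 * ∫ z in (0:ℝ)..1, ev R t x z) := by fun_prop
  have h1 : I δ t (S.b * (S.T - cst Γ 1)) ≤ ∫ x in (0:ℝ)..Γ,
      δ * (1 / 2 * (∫ z in (0:ℝ)..1, ev (D2 S.T ^ 2) t x z)
        + 1 / 2 * δ ^ 3 * ∫ z in (0:ℝ)..1, ev R t x z) := by
    apply intervalIntegral.integral_mono_on S.hΓ.le (outer_ii _ _ _ _ _) (cK.intervalIntegrable _ _)
    intro x _
    have h2 : ∫ y in (0:ℝ)..δ, ev (S.b * (S.T - cst Γ 1)) t x y ≤ ∫ y in (0:ℝ)..δ,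
        (1 / 2 * (∫ z in (0:ℝ)..1, ev (D2 S.T ^ 2) t x z)
        + 1 / 2 * δ ^ 3 * ∫ z in (0:ℝ)..1, ev R t x z) :=
      intervalIntegral.integral_mono_on hδ.1.le (inner_ii _ _ _ _ _) (by simp)
        fun y hy => key x y hy
    rwa [intervalIntegral.integral_const, smul_eq_mul, sub_zero] at h2
  refine h1.trans (le_of_eq ?_)
  rw [intervalIntegral.integral_const_mul, intervalIntegral.integral_add
    (Continuous.intervalIntegrable (by fun_prop) _ _) (Continuous.intervalIntegrable (by fun_prop) _ _),
    intervalIntegral.integral_const_mul, intervalIntegral.integral_const_mul]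
  rfl

end Sys
end

set_option linter.unusedSimpArgs false
/-- time average -/
def avg (d : ℝ) (f : Alg Γ) (t : ℝ) : ℝ := (1 / t) * ((1 / Γ) * ∫ s in (0:ℝ)..t, I d s f)

lemma ltavg_eq (hΓ : 0 < Γ) (d : ℝ) (f : Alg Γ) :
    ltavg Γ (fun t x1 => ∫ x2 in (0:ℝ)..d, ev f t x1 x2) = limsup (avg d f) atTop := by
  unfold ltavg
  apply limsup_congr
  filter_upwards [eventually_gt_atTop 0] with t ht
  rw [avg, ← intervalIntegral.integral_of_le ht.le, intervalIntegral.integral_const_mul]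
  congr 2
  apply intervalIntegral.integral_congr
  intro s _
  simp only [I]
  rw [intervalIntegral.integral_of_le hΓ.le]

lemma avg_nonneg (hΓ : 0 < Γ) {f : Alg Γ} (h : ∀ t, 0 ≤ I 1 t f) (t : ℝ) (ht : 0 < t) :
    0 ≤ avg 1 f t := by
  have : 0 ≤ ∫ s in (0:ℝ)..t, I 1 s f := intervalIntegral.integral_nonneg ht.le fun s _ => h s
  unfold avg
  positivity

lemma avg_bdd (hΓ : 0 < Γ) {f : Alg Γ} (h : ∃ C D : ℝ, 0 ≤ C ∧ 0 ≤ D ∧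
    ∀ t, 0 ≤ t → ∫ s in (0:ℝ)..t, I 1 s f ≤ C * t + D) : 
    IsBoundedUnder (· ≤ ·) atTop (avg 1 f) := by
  obtain ⟨C, D, hC, hD, h⟩ := h
  refine ⟨1 / Γ * (C + D), ?_⟩
  rw [eventually_map]
  filter_upwards [eventually_ge_atTop 1] with t ht
  have h0 : 0 < t := by linarith
  have h1 := h t h0.le
  have h2 : ∫ s in (0:ℝ)..t, I 1 s f ≤ (C + D) * t := by nlinarith
  have h3 : avg 1 f t ≤ 1 / t * (1 / Γ * ((C + D) * t)) := by unfold avg; gcongr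
  refine h3.trans (le_of_eq ?_)
  field_simp

lemma limsup_le_of_all {X : ℝ → ℝ} {c : ℝ} (hc : 0 ≤ c) (h : ∀ᶠ t in atTop, X t ≤ c) :
    limsup X atTop ≤ c := by
  rw [limsup_eq]
  by_cases hb : BddBelow {a | ∀ᶠ n in atTop, X n ≤ a}
  · exact csInf_le hb h
  · rw [Real.sInf_of_not_bddBelow hb]; exact hc

lemma limsup_nonneg {X : ℝ → ℝ} (h : ∀ t, 0 < t → 0 ≤ X t) : 0 ≤ limsup X atTop := by
  rw [limsup_eq]
  apply Real.sInf_nonneg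
  intro a ha
  obtain ⟨t, h1, h2⟩ := ((eventually_gt_atTop (0:ℝ)).and ha).exists
  exact (h t h1).trans h2

lemma lim_lemma {X A G H : ℝ → ℝ} {δ : ℝ} (hδ : 0 < δ)
    (hX : ∀ s, 0 < s → ∀ t, 0 < t → X t ≤ δ * (1 / 2 * A t + 1 / 2 * δ ^ 3 * (s * G t + H t / s)))
    (hA0 : ∀ t, 0 < t → 0 ≤ A t) (hG0 : ∀ t, 0 < t → 0 ≤ G t) (hH0 : ∀ t, 0 < t → 0 ≤ H t)
    (hA : IsBoundedUnder (· ≤ ·) atTop A) (hG : IsBoundedUnder (· ≤ ·) atTop G)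
    (hH : IsBoundedUnder (· ≤ ·) atTop H) :
    (1 / δ) * limsup X atTop ≤ (1 / 2) * limsup A atTop
      + 1 * δ ^ 3 * √(limsup G atTop) * √(limsup H atTop) := by
  have a0 := limsup_nonneg hA0
  have g0 := limsup_nonneg hG0
  have h0 := limsup_nonneg hH0
  have key : ∀ s, 0 < s → limsup X atTop ≤ δ * (1 / 2 * limsup A atTop
      + 1 / 2 * δ ^ 3 * (s * limsup G atTop + limsup H atTop / s)) := by
    intro s hs
    apply le_of_forall_pos_le_add
    intro η hη
    set Q := δ * (1 / 2 + 1 / 2 * δ ^ 3 * (s + 1 / s)) with hQ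
    have hQ0 : 0 < Q := by positivity
    have hε : 0 < η / Q := by positivity
    apply limsup_le_of_all
    · positivity
    filter_upwards [eventually_gt_atTop 0,
      eventually_lt_of_limsup_lt (lt_add_of_pos_right (limsup A atTop) hε) hA,
      eventually_lt_of_limsup_lt (lt_add_of_pos_right (limsup G atTop) hε) hG,
      eventually_lt_of_limsup_lt (lt_add_of_pos_right (limsup H atTop) hε) hH] with t ht i1 i2 i3
    have e : η = Q * (η / Q) := by field_simp
    calc X t ≤ _ := hX s hs t ht
      _ ≤ δ * (1 / 2 * (limsup A atTop + η / Q) + 1 / 2 * δ ^ 3 *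
        (s * (limsup G atTop + η / Q) + (limsup H atTop + η / Q) / s)) := by gcongr
      _ = δ * (1 / 2 * limsup A atTop
        + 1 / 2 * δ ^ 3 * (s * limsup G atTop + limsup H atTop / s)) + Q * (η / Q) := by
          generalize η / Q = ε
          rw [hQ]; ring
      _ = _ := by rw [← e]
  generalize limsup X atTop = x at *
  generalize limsup A atTop = a at *
  generalize limsup G atTop = g at *
  generalize limsup H atTop = h at *
  have := opt (X := (x / δ - 1 / 2 * a) * (2 / δ ^ 3)) g0 h0 (fun s hs => by
    have := key s hs
    have h1 : x / δ ≤ 1 / 2 * a + 1 / 2 * δ ^ 3 * (s * g + h / s) := by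
      rw [div_le_iff₀ hδ]; linarith
    have h2 : (x / δ - 1 / 2 * a) ≤ (1 / 2 * δ ^ 3 * (s * g + h / s)) := by linarith
    calc (x / δ - 1 / 2 * a) * (2 / δ ^ 3) ≤ (1 / 2 * δ ^ 3 * (s * g + h / s)) * (2 / δ ^ 3) :=
          mul_le_mul_of_nonneg_right h2 (by positivity)
      _ = s * g + h / s := by
          generalize s * g + h / s = z
          field_simp)
  have e : (x / δ - 1 / 2 * a) * (2 / δ ^ 3) = (x / δ - 1 / 2 * a) * 2 / δ ^ 3 := by ring
  rw [e, div_le_iff₀ (by positivity)] at this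
  have e2 : 1 / δ * x = x / δ := by ring
  rw [e2]
  linarith

lemma Sys.final {κ β : ℝ} (S : Sys Γ Ra κ β) {δ : ℝ} (hδ : δ ∈ Ioo (0:ℝ) 1) :
    (1 / δ) * limsup (avg δ (S.b * S.T)) atTop ≤ (1 / 2) * limsup (avg 1 (D2 S.T ^ 2)) atTop
      + 1 * δ ^ 3 * √(limsup (avg 1 S.G) atTop) * √(limsup (avg 1 S.HH) atTop) := by
  have hΓ := S.hΓ
  refine lim_lemma hδ.1 (fun s hs t ht => ?_) (avg_nonneg hΓ fun t => I_sq_nonneg t _ hΓ)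
    (avg_nonneg hΓ S.G_nonneg) (avg_nonneg hΓ S.HH_nonneg) (avg_bdd hΓ S.T_avg)
    (avg_bdd hΓ S.G_avg) (avg_bdd hΓ S.HH_avg)
  have cT := I_cont 1 (D2 S.T ^ 2)
  have cG := I_cont 1 S.G
  have cH := I_cont 1 S.HH
  have h1 : ∫ r in (0:ℝ)..t, I δ r (S.b * S.T) ≤ ∫ r in (0:ℝ)..t, δ * (1 / 2 * I 1 r (D2 S.T ^ 2)
      + 1 / 2 * δ ^ 3 * (s * I 1 r S.G + I 1 r S.HH / s)) :=
    intervalIntegral.integral_mono_on ht.le ((I_cont _ _).intervalIntegrable _ _)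
      (Continuous.intervalIntegrable (by fun_prop) _ _) fun r hr => S.main_t r hr.1 hδ hs
  rw [intervalIntegral.integral_const_mul, intervalIntegral.integral_add
    (Continuous.intervalIntegrable (by fun_prop) _ _) (Continuous.intervalIntegrable (by fun_prop) _ _),
    intervalIntegral.integral_const_mul, intervalIntegral.integral_const_mul,
    intervalIntegral.integral_add
    (Continuous.intervalIntegrable (by fun_prop) _ _) (Continuous.intervalIntegrable (by fun_prop) _ _),
    intervalIntegral.integral_const_mul, intervalIntegral.integral_div] at h1
  have h2 := mul_le_mul_of_nonneg_left (mul_le_mul_of_nonneg_left h1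
    (show 0 ≤ 1 / Γ by positivity)) (show 0 ≤ 1 / t by positivity)
  refine h2.trans (le_of_eq ?_)
  unfold avg
  ring

/-- a classical solution as data in the algebra -/
def Sol.toSys (S : Sol Γ Ra Pr Ls) (hΓ : 0 < Γ) (hRa : 0 < Ra) (hPr : 0 < Pr) (h0 : T0cond S) :
    Sys Γ Ra Pr⁻¹ (Ls⁻¹).toReal :=
  let a := toAlg S.smooth_u1 S.periodic_u1
  let b := toAlg S.smooth_u2 S.periodic_u2
  let T := toAlg S.smooth_T S.periodic_T
  let p := toAlg S.smooth_p S.periodic_p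
  have heat : ∀ t x y, 0 ≤ t → y ∈ Icc (0:ℝ) 1 → ev (Dt T) t x y + ev a t x y * ev (D1 T) t x y
      + ev b t x y * ev (D2 T) t x y - (ev (D1 (D1 T)) t x y + ev (D2 (D2 T)) t x y) = 0 := by
    simp only [← dt_ev, ← d1_ev, ← d2_ev]; exact S.heat
  { a := a
    b := b
    T := T
    p := p
    hΓ := hΓ
    hRa := hRa
    hκ := inv_pos.2 hPr
    hβ := ENNReal.toReal_nonneg
    m1 := by simp only [← dt_ev, ← d1_ev, ← d2_ev]; exact S.momentum1
    m2 := by simp only [← dt_ev, ← d1_ev, ← d2_ev]; exact S.momentum2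
    inc := by simp only [← d1_ev, ← d2_ev]; exact S.incomp
    heat := heat
    Tbot := S.T_bot
    Ttop := S.T_top
    bbot := S.u2_bot
    btop := S.u2_top
    sltop := by simp only [← d2_ev]; exact S.slip_top
    sbot := by simp only [← d2_ev]; exact S.slip_bot
    T01 := by
      intro t x y ht hy
      constructor
      · have := maxprinciple hΓ a b (cst Γ 1 - T) (fun t x y ht hy => by
          have := heat t x y ht hy
          simp only [D1_D2, Dt_D1, Dt_D2, Dt_add, D1_add, D2_add, Dt_sub, D1_sub, D2_sub, Dt_neg, D1_neg, D2_neg, Dt_mul, D1_mul, D2_mul,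
      Dt_sq, D1_sq, D2_sq, Dt_cst, D1_cst, D2_cst, Dt_X2, D1_X2, D2_X2, ev_add, ev_sub, ev_neg, ev_mul, ev_pow, ev_cst, ev_X2]
          linarith) (fun x y hy => by
            have := (h0 x y hy).1
            simp only [ev_sub, ev_cst]
            have e : ev T 0 x y = S.T 0 x y := rfl
            linarith) (fun t x ht => by
            have e : ev T t x 0 = 1 := S.T_bot t x ht
            simp only [ev_sub, ev_cst, e]; norm_num) (fun t x ht => by
            have e : ev T t x 1 = 0 := S.T_top t x ht
            simp only [ev_sub, ev_cst, e]; norm_num) t x y ht hy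
        simp only [ev_sub, ev_cst] at this
        linarith
      · exact maxprinciple hΓ a b T heat (fun x y hy => (h0 x y hy).2)
          (fun t x ht => (S.T_bot t x ht).le) (fun t x ht => (S.T_top t x ht).le.trans zero_le_one)
          t x y ht hy }

/-- interpolation bound. -/
theorem interpolation_bound :
    ∃ C : ℝ, 0 < C ∧ ∀ (Γ Ra Pr : ℝ) (Ls : ℝ≥0∞), 0 < Γ → 0 < Ra → 0 < Pr → Ls ≠ 0 →
      ∀ S : Sol Γ Ra Pr Ls, T0cond S → ∀ δ : ℝ, δ ∈ Ioo (0:ℝ) 1 →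
        (1/δ) * ltavg Γ (fun t x1 => ∫ x2 in (0:ℝ)..δ, S.u2 t x1 x2 * S.T t x1 x2) ≤
          (1/2) * ltavg Γ (fun t x1 => ∫ x2 in (0:ℝ)..1, d2 S.T t x1 x2 ^ 2)
          + C * δ ^ 3 *
            Real.sqrt (ltavg Γ (fun t x1 => ∫ x2 in (0:ℝ)..1, gradSq S t x1 x2)) *
            Real.sqrt (ltavg Γ (fun t x1 => ∫ x2 in (0:ℝ)..1, hessSq S t x1 x2)) := by
  refine ⟨1, one_pos, fun Γ Ra Pr Ls hΓ hRa hPr _ S h0 δ hδ => ?_⟩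
  have h := (S.toSys hΓ hRa hPr h0).final hδ
  set W := S.toSys hΓ hRa hPr h0 with hW
  rw [← ltavg_eq hΓ, ← ltavg_eq hΓ, ← ltavg_eq hΓ, ← ltavg_eq hΓ] at h
  have e1 : ev W.a = S.u1 := rfl
  have e2 : ev W.b = S.u2 := rfl
  have e3 : ev W.T = S.T := rfl
  have hg : gradSq S = ev W.G := by
    funext t x y
    simp only [gradSq, ← e1, ← e2, d1_ev, d2_ev, Sys.G, ev_add, ev_pow]
  have hh : hessSq S = ev W.HH := by
    funext t x y
    simp only [hessSq, ← e1, ← e2, d1_ev, d2_ev, Sys.HH, ev_add, ev_pow, ev_mul, ev_cst, D1_D2]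
    ring
  have hT : d2 S.T = ev (D2 W.T) := by rw [← e3, d2_ev]
  rw [hg, hh, hT]
  exact h

end RB
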